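/- arXiv:2505.00262 — 2 statements merged into one kernel-verified Lean document; each statement's English description precedes it below -/
import Mathlib

section
/- Suppose the HNN-extension 𝔼 = ⟨B, t; t⁻¹Ht = K, φ⟩ satisfies condition (*), 𝒞 is a root class of groups closed under taking quotient groups, and at least one of the following holds: (α) H/L ∈ 𝒞; (β) there exists a homomorphism of B onto a group from 𝒞 acting injectively on L. Suppose also that 𝔘 ∈ 𝒞, 𝔙 ∈ 𝒞, and B is 𝒞-quasi-regular with respect to HK. If B/H and B/K are residually 𝒞-groups, then 𝔼 is residually a 𝒞-group if and only if B is residually a 𝒞-group. -/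
universe u

open Subgroup

/-- A class of groups in universe `u`: a property of groups. -/
abbrev GroupClass : Type (u + 1) := (G : Type u) → [inst : Group G] → Prop

/-- The class is closed under isomorphism. -/
def IsoClosed (C : GroupClass.{u}) : Prop :=
  ∀ (G₁ G₂ : Type u) [Group G₁] [Group G₂], (G₁ ≃* G₂) → C G₁ → C G₂

/-- The class is closed under taking subgroups. -/
def SubgroupClosed (C : GroupClass.{u}) : Prop :=
  ∀ (G : Type u) [Group G] (H : Subgroup G), C G → C H

/-- The class is closed under taking quotient groups. -/
def QuotClosed (C : GroupClass.{u}) : Prop :=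
  ∀ (G : Type u) [Group G] (N : Subgroup G) [N.Normal], C G → C (G ⧸ N)

/-- The class is closed under direct products of a finite number of factors. -/
def FinProdClosed (C : GroupClass.{u}) : Prop :=
  ∀ (ι : Type u) [Finite ι] (G : ι → Type u) [∀ i, Group (G i)],
    (∀ i, C (G i)) → C (∀ i, G i)

/-- Gruenberg's condition. -/
def Gruenberg (C : GroupClass.{u}) : Prop :=
  ∀ (X : Type u) [Group X] (Y Z : Subgroup X) (_ : Z ≤ Y) (hY : Y.Normal)
    (hZY : (Z.subgroupOf Y).Normal), C (X ⧸ Y) → C (↥Y ⧸ Z.subgroupOf Y) →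
    ∃ T : Subgroup X, ∃ _ : T.Normal, T ≤ Z ∧ C (X ⧸ T)

/-- A root class of groups. -/
def IsRootClass (C : GroupClass.{u}) : Prop :=
  IsoClosed C ∧ (∃ (G : Type u) (_ : Group G), C G ∧ Nontrivial G) ∧
    SubgroupClosed C ∧ Gruenberg C

/-- `X` is residually a `C`-group. -/
def Residually (C : GroupClass.{u}) (X : Type u) [Group X] : Prop :=
  ∀ x : X, x ≠ 1 → ∃ (G : Type u) (_ : Group G) (f : X →* G),
    Function.Surjective f ∧ C G ∧ f x ≠ 1

/-- Every element has finite order. -/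
def Periodic (G : Type u) [Group G] : Prop := ∀ g : G, IsOfFinOrder g

/-- The class consists only of periodic groups. -/
def PeriodicClass (C : GroupClass.{u}) : Prop := ∀ (G : Type u) [Group G], C G → Periodic G

/-- `Aut_X(Y)`: the subgroup of `Aut(Y)` consisting of the restrictions to `Y`
of the inner automorphisms of `X` (that leave `Y` invariant; when `Y` is normal
in `X` these are the restrictions of all inner automorphisms of `X`). -/
def autOf (X : Type u) [Group X] (Y : Subgroup X) : Subgroup (MulAut Y) where
  carrier := { α | ∃ x : X, ∀ y : Y, ((α y : Y) : X) = x * y * x⁻¹ }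
  one_mem' := ⟨1, fun y => by simp⟩
  mul_mem' := by
    rintro α β ⟨a, ha⟩ ⟨b, hb⟩
    refine ⟨a * b, fun y => ?_⟩
    have h1 : ((α (β y) : Y) : X) = a * (β y) * a⁻¹ := ha (β y)
    have h2 : ((β y : Y) : X) = b * y * b⁻¹ := hb y
    show ((α (β y) : Y) : X) = _
    rw [h1, h2]; group
  inv_mem' := by
    rintro α ⟨a, ha⟩
    refine ⟨a⁻¹, fun y => ?_⟩
    have h : ((α (α⁻¹ y) : Y) : X) = a * (α⁻¹ y) * a⁻¹ := ha (α⁻¹ y)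
    rw [MulAut.apply_inv_self] at h
    rw [h]; group

/-- Conjugation of automorphism groups along an isomorphism `φ : H ≃* K`,
giving `φ ∘ α ∘ φ⁻¹ : Aut K →* Aut H`. -/
def autConjHom {H K : Type u} [Group H] [Group K] (φ : H ≃* K) : MulAut K →* MulAut H where
  toFun α := (φ.trans α).trans φ.symm
  map_one' := by ext x; simp
  map_mul' := fun α β => by
    ext x
    simp [MulAut.mul_apply, MulEquiv.trans_apply, MulEquiv.apply_symm_apply]

/-- `N ∈ 𝒞*(X)`: `N` is normal in `X` and `X/N ∈ 𝒞`. -/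
def inCStar (C : GroupClass.{u}) (X : Type u) [Group X] (N : Subgroup X) : Prop :=
  ∃ _ : N.Normal, C (X ⧸ N)

/-- `X` is `𝒞`-quasi-regular with respect to its subgroup `Y`. -/
def QuasiRegular (C : GroupClass.{u}) (X : Type u) [Group X] (Y : Subgroup X) : Prop :=
  ∀ M : Subgroup Y, inCStar C Y M → ∃ N : Subgroup X, inCStar C X N ∧ N.subgroupOf Y ≤ M

/-- `𝔓(𝒞)`: the set of primes dividing the order of some element of some `𝒞`-group. -/
def primesOf (C : GroupClass.{u}) : Set ℕ :=
  { p | p.Prime ∧ ∃ (Z : Type u) (_ : Group Z), C Z ∧ ∃ z : Z, p ∣ orderOf z }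

/-- `Y` is `𝔓(𝒞)′`-isolated in `X`. -/
def PIsolated (C : GroupClass.{u}) {X : Type u} [Group X] (Y : Subgroup X) : Prop :=
  ∀ (x : X) (q : ℕ), q.Prime → q ∉ primesOf C → x ^ q ∈ Y → x ∈ Y

/-- Every finitely generated subgroup is cyclic. -/
def LocallyCyclic (G : Type u) [Group G] : Prop :=
  ∀ S : Subgroup G, S.FG → IsCyclic S

/-- `A` is a `𝒞`-bounded abelian group. -/
def CBoundedAbelian (C : GroupClass.{u}) (A : Type u) [Group A] : Prop :=
  (∀ a b : A, a * b = b * a) ∧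
  ∀ (N : Subgroup A), ∀ _ : N.Normal, ∀ p ∈ primesOf C,
    (∃ m : ℕ, 0 < m ∧ ∀ x : A ⧸ N, (∃ n : ℕ, x ^ p ^ n = 1) → x ^ m = 1) ∧
    (∃ (Z : Type u) (_ : Group Z), C Z ∧
      Cardinal.mk {x : A ⧸ N // ∃ n : ℕ, x ^ p ^ n = 1} ≤ Cardinal.mk Z)

/-- `X` is a `𝒞`-bounded nilpotent group: it has a finite central series with
`𝒞`-bounded abelian factors. -/
def CBoundedNilpotent (C : GroupClass.{u}) (X : Type u) [Group X] : Prop :=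
  ∃ (n : ℕ) (S : ℕ → Subgroup X), S 0 = ⊥ ∧ S n = ⊤ ∧
    (∀ i < n, S i ≤ S (i + 1)) ∧ (∀ i < n, (S i).Normal) ∧
    (∀ i < n, ∀ x ∈ S (i + 1), ∀ g : X, g⁻¹ * x⁻¹ * g * x ∈ S i) ∧
    (∀ i < n, ∀ _ : ((S i).subgroupOf (S (i + 1))).Normal,
      CBoundedAbelian C (↥(S (i + 1)) ⧸ (S i).subgroupOf (S (i + 1))))

/-- `A` is a normal subgroup of `U` (as subgroups of a common group). -/
def NormalIn {G : Type u} [Group G] (A U : Subgroup G) : Prop := (A.subgroupOf U).Normal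

/-- `G` satisfies a non-trivial identity. -/
def SatisfiesNontrivialIdentity (G : Type u) [Group G] : Prop :=
  ∃ w : FreeGroup ℕ, w ≠ 1 ∧ ∀ f : FreeGroup ℕ →* G, f w = 1

section HNN

variable {B : Type u} [Group B] (H K : Subgroup B) (φ : H ≃* K)

/-- `𝔎 = φ ∘ Aut_B(K) ∘ φ⁻¹`, as a subgroup of `Aut(H)`. -/
def frakK : Subgroup (MulAut H) := (autOf B K).map (autConjHom φ)

/-- `𝔘 = ⟨𝔥, 𝔎⟩ ≤ Aut(H)`. -/
def frakU : Subgroup (MulAut H) := autOf B H ⊔ frakK H K φ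

/-- `𝔙 = ⟨𝔏, 𝔉⟩ ≤ Aut(L)`, where `ψ = φ|_L`. -/
def frakV (ψ : MulAut ↥(H ⊓ K)) : Subgroup (MulAut ↥(H ⊓ K)) :=
  autOf B (H ⊓ K) ⊔ Subgroup.zpowers ψ

/-- `ψ` is the restriction of `φ` to `L = H ⊓ K` (this encodes the
`φ`-invariance of `L` from condition (*)). -/
def IsRestrictionToL (ψ : MulAut ↥(H ⊓ K)) : Prop :=
  ∀ x : ↥(H ⊓ K), ((ψ x : ↥(H ⊓ K)) : B) = ((φ ⟨(x : B), x.2.1⟩ : K) : B)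

/-- `(H ⊓ K)φ = H ⊓ K` : the `φ`-invariance of `L` from condition (*). -/
def PhiInvL : Prop :=
  ((H ⊓ K).subgroupOf H).map φ.toMonoidHom = (H ⊓ K).subgroupOf K

end HNN

section HNNExtra

variable (C : GroupClass.{u}) {B : Type u} [Group B] (H K : Subgroup B) (φ : H ≃* K)

/-- Condition (†): at least one of `𝔥` and `𝔎` is normal in `𝔘`, or `𝔘 ∈ 𝒞`. -/
def CondDag : Prop :=
  NormalIn (autOf B H) (frakU H K φ) ∨ NormalIn (frakK H K φ) (frakU H K φ) ∨
    C ↥(frakU H K φ)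

/-- Condition (‡): at least one of `𝔏` and `𝔉` is normal in `𝔙`, or `𝔙 ∈ 𝒞`. -/
def CondDDag (ψ : MulAut ↥(H ⊓ K)) : Prop :=
  NormalIn (autOf B (H ⊓ K)) (frakV H K ψ) ∨
    NormalIn (Subgroup.zpowers ψ) (frakV H K ψ) ∨ C ↥(frakV H K ψ)

/-- `Q` is a pre-`𝒞`-admissible subgroup of `B`: it is normal, `(H,K,φ)`-compatible,
`B/Q ∈ 𝒞`, and `HQ/Q ∩ KQ/Q = LQ/Q`. -/
def PreAdmissible (Q : Subgroup B) : Prop :=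
  ∃ _ : Q.Normal, ((Q ⊓ H).subgroupOf H).map φ.toMonoidHom = (Q ⊓ K).subgroupOf K ∧
    C (B ⧸ Q) ∧
    (H.map (QuotientGroup.mk' Q)) ⊓ (K.map (QuotientGroup.mk' Q)) =
      (H ⊓ K).map (QuotientGroup.mk' Q)

end HNNExtra

namespace RootClass

variable {C : GroupClass.{u}}

theorem of_injective (hroot : IsRootClass C) {X G : Type u} [Group X] [Group G] (f : X →* G)
    (hf : Function.Injective f) (hG : C G) : C X :=
  hroot.1 _ _ (MonoidHom.ofInjective hf).symm (hroot.2.2.1 _ _ hG)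

theorem of_surjective (hroot : IsRootClass C) (hquot : QuotClosed C) {X G : Type u} [Group X]
    [Group G] (f : X →* G) (hf : Function.Surjective f) (hX : C X) : C G :=
  hroot.1 _ _ (QuotientGroup.quotientKerEquivOfSurjective f hf) (hquot _ f.ker hX)

theorem quotient_of_ker_le (hroot : IsRootClass C) (hquot : QuotClosed C) {X G : Type u} [Group X]
    [Group G] (f : X →* G) (hG : C G) (N : Subgroup X) [N.Normal] (hN : f.ker ≤ N) :
    C (X ⧸ N) := by
  have h1 : C (X ⧸ f.ker) :=
    of_injective hroot (QuotientGroup.kerLift f) (QuotientGroup.kerLift_injective f) hG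
  refine of_surjective hroot hquot
    (QuotientGroup.map f.ker N (MonoidHom.id X) (by simpa using hN)) ?_ h1
  intro y
  obtain ⟨x, rfl⟩ := QuotientGroup.mk_surjective y
  exact ⟨(x : X ⧸ f.ker), rfl⟩

/-- Gruenberg's condition in terms of homomorphisms. -/
theorem exists_hom_of_hom_ker (hroot : IsRootClass C) {X G D : Type u} [Group X] [Group G]
    [Group D] (f : X →* G) (hG : C G) (g : f.ker →* D) (hD : C D) :
    ∃ (G' : Type u) (_ : Group G') (F : X →* G'), C G' ∧
      ∀ x, F x = 1 → ∃ h : x ∈ f.ker, g ⟨x, h⟩ = 1 := by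
  have hsub : (g.ker.map f.ker.subtype).subgroupOf f.ker = g.ker :=
    Subgroup.comap_map_eq_self_of_injective (Subgroup.subtype_injective _) _
  have hn : ((g.ker.map f.ker.subtype).subgroupOf f.ker).Normal := by
    rw [hsub]; infer_instance
  obtain ⟨T, hT, hTle, hTC⟩ := hroot.2.2.2 X f.ker (g.ker.map f.ker.subtype)
    (Subgroup.map_subtype_le _) inferInstance hn
    (of_injective hroot (QuotientGroup.kerLift f) (QuotientGroup.kerLift_injective f) hG)
    (by
      refine of_injective hroot (QuotientGroup.lift _ g (hsub.le)) ?_ hD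
      rw [injective_iff_map_eq_one]
      intro y
      obtain ⟨x, rfl⟩ := QuotientGroup.mk_surjective y
      intro hx
      rw [QuotientGroup.eq_one_iff, hsub]
      exact hx)
  refine ⟨X ⧸ T, inferInstance, QuotientGroup.mk' T, hTC, fun x hx => ?_⟩
  obtain ⟨y, hy, rfl⟩ := hTle ((QuotientGroup.eq_one_iff x).1 hx)
  exact ⟨y.2, hy⟩

theorem of_hom_ker (hroot : IsRootClass C) {X G D : Type u} [Group X] [Group G]
    [Group D] (f : X →* G) (hG : C G) (g : f.ker →* D) (hD : C D)
    (hinj : ∀ x (h : x ∈ f.ker), g ⟨x, h⟩ = 1 → x = 1) : C X := by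
  obtain ⟨G', _, F, hG', hF⟩ := exists_hom_of_hom_ker hroot f hG g hD
  refine of_injective hroot F ((injective_iff_map_eq_one F).2 fun x hx => ?_) hG'
  obtain ⟨h, h'⟩ := hF x hx
  exact hinj x h h'

theorem prod (hroot : IsRootClass C) {G D : Type u} [Group G] [Group D] (hG : C G) (hD : C D) :
    C (G × D) :=
  of_hom_ker hroot (MonoidHom.fst G D) hG ((MonoidHom.snd G D).comp (Subgroup.subtype _)) hD
    fun _ h h' => Prod.ext h h'

theorem semidirectProduct (hroot : IsRootClass C) {N A : Type u} [Group N] [Group A]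
    (f : A →* MulAut N) (hN : C N) (hA : C A) : C (N ⋊[f] A) := by
  let g : (SemidirectProduct.rightHom : N ⋊[f] A →* A).ker →* N :=
    { toFun := fun x => x.1.left
      map_one' := rfl
      map_mul' := fun x y => by
        have hx : x.1.right = 1 := x.2
        simp [hx] }
  exact of_hom_ker hroot SemidirectProduct.rightHom hA g hN
    fun x h h' => SemidirectProduct.ext h' h

/-- A root class is closed under regular wreath products. -/
theorem wreath (hroot : IsRootClass C) {D Q : Type u} [Group D] [Group Q] (hD : C D) (hQ : C Q) :
    C (D ≀ᵣ Q) := by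
  let g : (RegularWreathProduct.rightHom : D ≀ᵣ Q →* Q).ker →* D :=
    { toFun := fun x => x.1.left 1
      map_one' := rfl
      map_mul' := fun x y => by
        have hx : x.1.right = 1 := x.2
        simp [hx] }
  obtain ⟨G', _, F, hG', hF⟩ := exists_hom_of_hom_ker hroot RegularWreathProduct.rightHom hQ g hD
  refine of_injective hroot F ((injective_iff_map_eq_one F).2 fun x hx => ?_) hG'
  obtain ⟨h, -⟩ := hF x hx
  refine RegularWreathProduct.ext (funext fun q => ?_) h
  have hx' : F (RegularWreathProduct.inl q⁻¹ * x * (RegularWreathProduct.inl q⁻¹)⁻¹) = 1 := by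
    simp [hx]
  obtain ⟨_, h'⟩ := hF _ hx'
  simpa [g] using h'

theorem sup (hroot : IsRootClass C) (hquot : QuotClosed C) {G : Type u} [Group G]
    (A B : Subgroup G) [hA : A.Normal] (hCA : C A) (hCB : C B) : C ↥(A ⊔ B) := by
  let f : ↥(A ⊔ B) →* G ⧸ A := (QuotientGroup.mk' A).comp (Subgroup.subtype _)
  have hr : f.rangeRestrict.ker = f.ker := MonoidHom.ker_rangeRestrict f
  have hran : f.range = ((QuotientGroup.mk' A).comp B.subtype).range := by
    simp only [f, MonoidHom.range_comp, Subgroup.range_subtype, Subgroup.map_sup]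
    simp
  have hk : ∀ x : f.rangeRestrict.ker, (x.1 : G) ∈ A := fun x =>
    (QuotientGroup.eq_one_iff _).1 (hr.le x.2)
  refine of_hom_ker hroot f.rangeRestrict ?_
    (((Subgroup.subtype _).comp (Subgroup.subtype _)).codRestrict A hk) hCA ?_
  · rw [hran]
    exact of_surjective hroot hquot _ (MonoidHom.rangeRestrict_surjective _) hCB
  · intro x h hx
    exact Subtype.ext (congrArg (fun z : A => (z : G)) hx)

theorem exists_semidirect_hom (hroot : IsRootClass C) {N D : Type u} [Group N] [Group D]
    (A : Subgroup (MulAut N)) (hA : C A) (α : N →* D) (hD : C D) :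
    ∃ (G : Type u) (_ : Group G) (F : N ⋊[A.subtype] A →* G), C G ∧
      ∀ n, F (SemidirectProduct.inl n) = 1 → α n = 1 := by
  let g : (SemidirectProduct.rightHom : N ⋊[A.subtype] A →* A).ker →* N :=
    { toFun := fun x => x.1.left
      map_one' := rfl
      map_mul' := fun x y => by
        have hx : x.1.right = 1 := x.2
        simp [hx] }
  obtain ⟨G, _, F, hG, hF⟩ := exists_hom_of_hom_ker hroot SemidirectProduct.rightHom hA
    (α.comp g) hD
  exact ⟨G, _, F, hG, fun n hn => (hF _ hn).2⟩

end RootClass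

section WreathLift

theorem exists_coset_representatives {B G : Type u} [Group B] [Group G] (σ : B →* G) :
    ∃ (r : G → G) (s : G → B), (∀ g, σ (s g) * r g = g) ∧ ∀ x g, r (σ x * g) = r g := by
  let r : G → G := fun g => (Quotient.mk (QuotientGroup.rightRel σ.range) g).out
  have hr : ∀ g, ∃ b, σ b = g * (r g)⁻¹ := fun g =>
    QuotientGroup.rightRel_apply.1 (Quotient.mk_out (s := QuotientGroup.rightRel σ.range) g)
  choose s hs using hr
  refine ⟨r, s, fun g => by rw [hs]; group, fun x g => ?_⟩
  have : (Quotient.mk (QuotientGroup.rightRel σ.range) (σ x * g)) =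
      Quotient.mk (QuotientGroup.rightRel σ.range) g := by
    refine Quotient.sound (QuotientGroup.rightRel_apply.2 ⟨x⁻¹, ?_⟩)
    simp
  simp only [r, this]

/-- A homomorphism `θ` defined on the kernel of `σ : B →* G` which is equivariant along
`a : B →* D` extends, as a constant function, to a lift of `σ` to the wreath product. -/
theorem exists_wreath_lift {B G D : Type u} [Group B] [Group G] [Group D] (σ : B →* G)
    (θ : σ.ker →* D) (a : B →* D)
    (hθ : ∀ (x : B) (n n' : σ.ker), (n' : B) = x * n * x⁻¹ → a x * θ n = θ n' * a x) :
    ∃ ρ : B →* D ≀ᵣ G, (∀ x, (ρ x).right = σ x) ∧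
      ∀ (n : σ.ker) (g : G), (ρ n).left g = θ n := by
  obtain ⟨r, s, hs, hr⟩ := exists_coset_representatives σ
  have hs' : ∀ x g, σ (s (σ x * g)) = σ x * σ (s g) := fun x g => by
    have h1 := hs (σ x * g)
    rw [hr] at h1
    rw [eq_mul_inv_of_mul_eq h1, mul_assoc, ← eq_mul_inv_of_mul_eq (hs g)]
  have hs'' : ∀ x g, σ (s ((σ x)⁻¹ * g)) = (σ x)⁻¹ * σ (s g) := fun x g => by
    simpa using hs' x⁻¹ g
  have hmem : ∀ x g, x * s ((σ x)⁻¹ * g) * (s g)⁻¹ ∈ σ.ker := fun x g => by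
    simp [MonoidHom.mem_ker, hs'']
  let f : B → G → D := fun x g =>
    θ ⟨_, hmem x g⟩ * (a (s g) * (a (s ((σ x)⁻¹ * g)))⁻¹)
  have hf : ∀ x y g, f (x * y) g = f x g * f y ((σ x)⁻¹ * g) := by
    intro x y g
    have e : (σ (x * y))⁻¹ * g = (σ y)⁻¹ * ((σ x)⁻¹ * g) := by simp [mul_assoc]
    have hm' := hmem (x * y) g
    simp only [f]
    have e1 : θ ⟨_, hmem (x * y) g⟩ = θ ⟨_, hmem x g⟩ *
        θ ⟨_, (inferInstance : σ.ker.Normal).conj_mem _ (hmem y ((σ x)⁻¹ * g))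
          (s g * (s ((σ x)⁻¹ * g))⁻¹)⟩ := by
      rw [← map_mul]
      congr 1
      ext
      simp
      group
    rw [e1, e]
    have e2 := hθ (s g * (s ((σ x)⁻¹ * g))⁻¹) ⟨_, hmem y ((σ x)⁻¹ * g)⟩
      ⟨_, (inferInstance : σ.ker.Normal).conj_mem _ (hmem y ((σ x)⁻¹ * g))
          (s g * (s ((σ x)⁻¹ * g))⁻¹)⟩ rfl
    rw [map_mul, map_inv] at e2
    simp only [mul_assoc] at e2 ⊢
    rw [← mul_assoc (a (s ((σ x)⁻¹ * g)))⁻¹ (θ _), ← mul_assoc (a (s g)), ← mul_assoc (a (s g)),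
      mul_assoc (a (s g)) _ (θ _), e2]
    simp [mul_assoc]
  have hker : ∀ (n : σ.ker) (g : G), f n g = θ n := by
    intro n g
    have hn : σ n = 1 := n.2
    have : (⟨_, hmem n g⟩ : σ.ker) = n := by ext; simp [hn]
    simp only [f, this]
    simp [hn]
  refine ⟨MonoidHom.mk' (fun x => ⟨f x, σ x⟩) fun x y => ?_, fun x => rfl, fun n g => hker n g⟩
  refine RegularWreathProduct.ext (funext fun g => ?_) (map_mul σ x y)
  exact hf x y g

/-- Two homomorphisms to a wreath product with the same projection which agree on the kernel of
this projection are conjugate by an element of the base. -/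
theorem exists_wreath_conj {Y D G : Type u} [Group Y] [Group D] [Group G] (ρ₁ ρ₂ : Y →* D ≀ᵣ G)
    (hr : ∀ y, (ρ₁ y).right = (ρ₂ y).right) (hk : ∀ y, (ρ₁ y).right = 1 → ρ₁ y = ρ₂ y) :
    ∃ v : D ≀ᵣ G, v.right = 1 ∧ ∀ y, v * ρ₁ y = ρ₂ y * v := by
  obtain ⟨r, s, hs, hrep⟩ := exists_coset_representatives
    ((RegularWreathProduct.rightHom : D ≀ᵣ G →* G).comp ρ₁)
  simp only [MonoidHom.comp_apply, RegularWreathProduct.rightHom_eq_right] at hs hrep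
  have hind : ∀ y z : Y, (ρ₁ y).right = (ρ₁ z).right →
      ρ₂ y * (ρ₁ y)⁻¹ = ρ₂ z * (ρ₁ z)⁻¹ := by
    intro y z h
    have h1 := hk (z⁻¹ * y) (by simp [h])
    rw [map_mul, map_mul, map_inv, map_inv] at h1
    rw [mul_inv_eq_iff_eq_mul, mul_assoc, h1]
    group
  refine ⟨⟨fun g => (ρ₂ (s g) * (ρ₁ (s g))⁻¹).left g, 1⟩, rfl, fun y => ?_⟩
  refine RegularWreathProduct.ext (funext fun g => ?_) (by simp [hr])
  set s' := s ((ρ₁ y).right⁻¹ * g) with hs'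
  have h1 : (ρ₁ (s g)).right = (ρ₁ (y * s')).right := by
    have h2 := hs ((ρ₁ y).right⁻¹ * g)
    have h3 := hrep y⁻¹ g
    simp only [map_inv, RegularWreathProduct.inv_right] at h3
    rw [h3, ← eq_mul_inv_iff_mul_eq] at h2
    have h4 := hs g
    rw [← eq_mul_inv_iff_mul_eq] at h4
    rw [h4, map_mul, RegularWreathProduct.mul_right, h2]
    group
  have h2 : ρ₂ (s g) * (ρ₁ (s g))⁻¹ * ρ₁ y = ρ₂ y * (ρ₂ s' * (ρ₁ s')⁻¹) := by
    rw [hind _ _ h1, map_mul, map_mul]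
    group
  have h3 := congrFun (congrArg RegularWreathProduct.left h2) g
  have h4 : (ρ₂ (s g) * (ρ₁ (s g))⁻¹).right = 1 := by simp [hr]
  rw [RegularWreathProduct.mul_left, RegularWreathProduct.mul_left (ρ₂ y), h4] at h3
  simpa [hs', hr] using h3

end WreathLift

section HNNLift

open HNNExtension

theorem HNNExtension.exists_wreath_lift {B G D : Type u} [Group B] [Group G] [Group D]
    {H K : Subgroup B} {φ : H ≃* K} (σ : HNNExtension B H K φ →* G)
    (θ : (σ.comp of).ker →* D) (a : HNNExtension B H K φ →* D)
    (hθ : ∀ (x : B) (n n' : (σ.comp of).ker), (n' : B) = x * n * x⁻¹ →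
      a (of x) * θ n = θ n' * a (of x))
    (hθt : ∀ (h : H) (n n' : (σ.comp of).ker), (n : B) = h → (n' : B) = φ h →
      a t * θ n = θ n' * a t) :
    ∃ ρ : HNNExtension B H K φ →* D ≀ᵣ G, (∀ x, (ρ x).right = σ x) ∧
      ∀ (n : (σ.comp of).ker) (g : G), (ρ (of n)).left g = θ n := by
  obtain ⟨ρ, hρr, hρ⟩ := _root_.exists_wreath_lift (σ.comp of) θ (a.comp of) hθ
  let c : D ≀ᵣ G := ⟨fun _ => a t, σ t⟩
  have hright : ∀ h : H, σ t * σ (of (h : B)) = σ (of (φ h : B)) * σ t := fun h => by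
    rw [← map_mul, ← map_mul, t_mul_of]
  obtain ⟨v, hv, hvc⟩ := exists_wreath_conj
    ((MulAut.conj c).toMonoidHom.comp (ρ.comp H.subtype))
    (ρ.comp (K.subtype.comp φ.toMonoidHom))
    (fun h => by
      have := hright h
      simp only [MonoidHom.comp_apply] at hρr
      simp [hρr, c, this])
    (fun h hh => by
      have hn' : (φ h : B) ∈ (σ.comp of).ker := by
        have := hright h
        simp only [MonoidHom.comp_apply] at hρr
        simp only [MonoidHom.comp_apply, MulEquiv.coe_toMonoidHom, MulAut.conj_apply,
          RegularWreathProduct.mul_right, RegularWreathProduct.inv_right, hρr, c,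
          Subgroup.coe_subtype, this] at hh
        simpa using hh
      have hn : (h : B) ∈ (σ.comp of).ker := by
        have h1 := hright h
        have h2 : σ (of (φ h : B)) = 1 := hn'
        rw [h2] at h1
        simpa [MonoidHom.mem_ker] using h1
      simp only [MonoidHom.comp_apply, MulEquiv.coe_toMonoidHom, MulAut.conj_apply,
        Subgroup.coe_subtype]
      rw [mul_inv_eq_iff_eq_mul]
      have hr1 := hρr h
      have hr2 := hρr (φ h)
      rw [MonoidHom.mem_ker.1 hn] at hr1
      rw [MonoidHom.mem_ker.1 hn'] at hr2
      refine RegularWreathProduct.ext (funext fun g => ?_) ?_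
      · have e1 := hρ ⟨_, hn⟩
        have e2 := hρ ⟨_, hn'⟩
        simp only at e1 e2
        simp [e1, e2, c, hθt h ⟨_, hn⟩ ⟨_, hn'⟩ rfl rfl]
      · simp [hr1, hr2])
  have hlift : ∀ h : H, v * c * ρ h = ρ (φ h) * (v * c) := fun h => by
    have := hvc h
    simp only [MonoidHom.comp_apply, MulEquiv.coe_toMonoidHom, MulAut.conj_apply,
        Subgroup.coe_subtype] at this
    rw [← mul_assoc, ← mul_assoc, mul_inv_eq_iff_eq_mul] at this
    rw [this, mul_assoc]
  refine ⟨HNNExtension.lift ρ (v * c) hlift, ?_, fun n g => ?_⟩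
  · have : (RegularWreathProduct.rightHom : D ≀ᵣ G →* G).comp
        (HNNExtension.lift ρ (v * c) hlift) = σ := by
      ext x
      · simpa using hρr x
      · simp [hv, c]
    exact fun x => DFunLike.congr_fun this x
  · simpa using hρ n g

/-- Two homomorphisms of the base group, one killing `H` and the other killing `K`, which are
intertwined by `φ`, extend to the HNN-extension by shifting coordinates in a wreath product. -/
theorem HNNExtension.exists_shift {B P Z : Type u} [Group B] [Group P] [Group Z]
    {H K : Subgroup B} (φ : H ≃* K) (ρ₀ ρ₁ : B →* P) (h₀ : ∀ h ∈ H, ρ₀ h = 1)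
    (h₁ : ∀ k ∈ K, ρ₁ k = 1) (h₀₁ : ∀ h : H, ρ₀ (φ h) = ρ₁ h) (z : Z) (hz : z ≠ 1) :
    ∃ σ : HNNExtension B H K φ →* P ≀ᵣ Z,
      ∀ b, σ (of b) = 1 → ρ₀ b = 1 ∧ ρ₁ b = 1 := by
  classical
  let f : B →* P ≀ᵣ Z := MonoidHom.mk'
    (fun b => ⟨fun i => if i = 1 then ρ₀ b else if i = z then ρ₁ b else 1, 1⟩)
    (fun x y => by
      ext i
      · simp only [RegularWreathProduct.mul_left, Pi.mul_apply, inv_one, one_mul, map_mul]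
        split_ifs <;> simp
      · simp)
  refine ⟨HNNExtension.lift f (RegularWreathProduct.inl z⁻¹) fun h => ?_, fun b hb => ?_⟩
  · refine RegularWreathProduct.ext (funext fun i => ?_) (by simp [f])
    have hz' : ∀ i, z * i = z ↔ i = 1 := fun i => by simp
    simp only [f, MonoidHom.mk'_apply, RegularWreathProduct.mul_left, Pi.mul_apply,
      RegularWreathProduct.left_inl, RegularWreathProduct.right_inl, inv_inv, Pi.one_apply,
      one_mul, mul_one, hz', h₀ _ h.2, h₁ _ (φ h).2, h₀₁ h]
    by_cases h1 : i = 1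
    · subst h1; simp [hz]
    · simp [h1]
  · rw [lift_of] at hb
    have hb' := congrArg RegularWreathProduct.left hb
    have e1 := congrFun hb' 1
    have e2 := congrFun hb' z
    simp only [f, MonoidHom.mk'_apply, if_true, if_neg hz] at e1 e2
    exact ⟨e1, e2⟩

end HNNLift

section Separation

/-- Some homomorphism onto a `C`-group sends `x` outside of the image of `S`. -/
def CSeparates (C : GroupClass.{u}) {X : Type u} [Group X] (x : X) (S : Set X) : Prop :=
  ∃ (G : Type u) (_ : Group G) (σ : X →* G), C G ∧ σ x ∉ σ '' S

theorem CSeparates.exists_common {C : GroupClass.{u}} (hroot : IsRootClass C) {X : Type u} [Group X]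
    {T : Set (X × Set X)} (hT : T.Finite) (h : ∀ p ∈ T, CSeparates C p.1 p.2) :
    ∃ (G : Type u) (_ : Group G) (σ : X →* G), C G ∧ ∀ p ∈ T, σ p.1 ∉ σ '' p.2 := by
  induction T, hT using Set.Finite.induction_on with
  | empty =>
    obtain ⟨Z, _, hZ, -⟩ := hroot.2.1
    exact ⟨Z, _, 1, hZ, by simp⟩
  | insert _ _ ih =>
    obtain ⟨G₁, _, σ₁, hG₁, h₁⟩ := ih fun p hp => h p (Set.mem_insert_of_mem _ hp)
    obtain ⟨G₂, _, σ₂, hG₂, h₂⟩ := h _ (Set.mem_insert _ _)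
    refine ⟨G₁ × G₂, _, σ₁.prod σ₂, RootClass.prod hroot hG₁ hG₂, ?_⟩
    rintro p (rfl | hp) ⟨s, hs, e⟩
    · exact h₂ ⟨s, hs, congrArg Prod.snd e⟩
    · exact h₁ p hp ⟨s, hs, congrArg Prod.fst e⟩

theorem RegularWreathProduct.left_list_prod_eq_one {X D G α : Type*} [Group X] [Group D] [Group G]
    (Φ : X →* D ≀ᵣ G) (w : α → X) (l : List α) (g : G)
    (h : ∀ A x A', l = A ++ x :: A' → (Φ (w x)).left ((Φ (A.map w).prod).right⁻¹ * g) = 1) :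
    (Φ (l.map w).prod).left g = 1 := by
  induction l generalizing g with
  | nil => simp
  | cons x l ih =>
    have h1 := h [] x l rfl
    have h2 := ih ((Φ (w x)).right⁻¹ * g) fun A y A' e => by
      have := h (x :: A) y A' (by rw [e]; rfl)
      simpa [mul_assoc] using this
    simp only [List.map_nil, List.prod_nil, map_one, RegularWreathProduct.one_right, inv_one,
      one_mul] at h1
    simp [h1, h2]

open HNNExtension

variable {C : GroupClass.{u}} {B : Type u} [Group B] {H K : Subgroup B} {φ : H ≃* K}

/-- The element `t ^ u₁ * b₁ * t ^ u₂ * b₂ * ⋯` of an HNN-extension. -/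
def HNNExtension.word (φ : H ≃* K) (l : List (ℤˣ × B)) : HNNExtension B H K φ :=
  (l.map (fun x => t ^ (x.1 : ℤ) * of x.2)).prod

theorem HNNExtension.word_cons (x : ℤˣ × B) (l : List (ℤˣ × B)) :
    word φ (x :: l) = t ^ (x.1 : ℤ) * of x.2 * word φ l := by
  simp [word]

theorem HNNExtension.exists_chain_of_mul_word (x : HNNExtension B H K φ) :
    ∃ (b : B) (l : List (ℤˣ × B)),
      l.IsChain (fun p q => p.2 ∈ toSubgroup H K p.1 → p.1 = q.1) ∧ x = of b * word φ l := by
  classical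
  obtain ⟨d⟩ := NormalWord.TransversalPair.nonempty B H K
  let w : NormalWord d := NormalWord.equiv φ d x
  refine ⟨w.head, w.toList, w.chain, ?_⟩
  exact ((NormalWord.equiv φ d).symm_apply_apply x).symm

theorem HNNExtension.cSeparates_word (hroot : IsRootClass C)
    (hH : ∀ b ∉ H, CSeparates C (of b : HNNExtension B H K φ) (of '' H))
    (hK : ∀ b ∉ K, CSeparates C (of b : HNNExtension B H K φ) (of '' K))
    (l : List (ℤˣ × B)) (hl : l ≠ [])
    (hc : l.IsChain (fun p q => p.2 ∈ toSubgroup H K p.1 → p.1 = q.1)) :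
    CSeparates C (word φ l) (Set.range of) := by
  classical
  induction hn : l.length using Nat.strong_induction_on generalizing l with
  | _ n ih =>
  subst hn
  obtain ⟨⟨e, b⟩, l, rfl⟩ := List.exists_cons_of_ne_nil hl
  have hfin : {A | A <+: l}.Finite := by
    refine (List.finite_toSet l.inits).subset fun A hA => ?_
    simpa using hA
  obtain ⟨G, _, σ, hG, hσ⟩ : ∃ (G : Type u) (_ : Group G) (σ : HNNExtension B H K φ →* G), C G ∧
      (∀ A x A', l = A ++ x :: A' → σ (word φ ((e, b) :: A)) ∉ σ '' Set.range of) ∧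
      (∀ A x A', l = A ++ x :: A' → A ≠ [] → σ (word φ A) ∉ σ '' Set.range of) ∧
      (b ∉ H → σ (of b) ∉ σ '' (of '' H)) ∧ (b ∉ K → σ (of b) ∉ σ '' (of '' K)) := by
    let T : Set (HNNExtension B H K φ × Set (HNNExtension B H K φ)) :=
      ((fun A => (word φ ((e, b) :: A), Set.range of)) '' {A | A <+: l ∧ A ≠ l}) ∪
      ((fun A => (word φ A, Set.range of)) '' {A | A <+: l ∧ A ≠ []}) ∪
      {p | b ∉ H ∧ p = (of b, of '' H)} ∪ {p | b ∉ K ∧ p = (of b, of '' K)}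
    have hT : T.Finite := by
      refine ((Set.Finite.union ?_ ?_).union ?_).union ?_
      · exact (hfin.subset fun A hA => hA.1).image _
      · exact (hfin.subset fun A hA => hA.1).image _
      · exact (Set.finite_singleton _).subset fun p hp => hp.2
      · exact (Set.finite_singleton _).subset fun p hp => hp.2
    obtain ⟨G, _, σ, hG, h⟩ := CSeparates.exists_common hroot hT (by
      rintro p (((⟨A, ⟨hA, hA'⟩, rfl⟩ | ⟨A, ⟨hA, hA'⟩, rfl⟩) | ⟨hb, rfl⟩) | ⟨hb, rfl⟩)
      · refine ih _ ?_ _ (by simp) (hc.prefix (by simpa using hA)) rfl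
        have : A.length ≠ l.length := fun h => hA' (hA.eq_of_length h)
        have := hA.length_le
        simp only [List.length_cons]
        omega
      · refine ih _ ?_ _ hA' (hc.tail.prefix hA) rfl
        have := hA.length_le
        simp only [List.length_cons]
        omega
      · exact hH b hb
      · exact hK b hb)
    refine ⟨G, _, σ, hG, ?_, ?_, ?_, ?_⟩
    · rintro A x A' rfl
      exact h _ (Or.inl (Or.inl (Or.inl ⟨A, ⟨by simp, by simp⟩, rfl⟩)))
    · rintro A x A' rfl hA
      exact h _ (Or.inl (Or.inl (Or.inr ⟨A, ⟨by simp, hA⟩, rfl⟩)))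
    · exact fun hb => h _ (Or.inl (Or.inr ⟨hb, rfl⟩))
    · exact fun hb => h _ (Or.inr ⟨hb, rfl⟩)
  obtain ⟨hσ₁, hσ₂, hσH, hσK⟩ := hσ
  obtain ⟨Z, _, hZ, _⟩ := hroot.2.1
  obtain ⟨z, hz⟩ := exists_ne (1 : Z)
  suffices ∃ Φ : HNNExtension B H K φ →* Z ≀ᵣ G, (∀ b, (Φ (of b)).left = 1) ∧
      (Φ (word φ ((e, b) :: l))).left 1 ≠ 1 by
    obtain ⟨Φ, hΦ, hΦ'⟩ := this
    refine ⟨_, _, Φ, RootClass.wreath hroot hZ hG, ?_⟩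
    rintro ⟨_, ⟨b', rfl⟩, h⟩
    rw [← h, hΦ] at hΦ'
    exact hΦ' rfl
  -- reduction to the choice of a suitable indicator function
  suffices ∃ f : G → Z, (∀ (k : K) g, f ((σ (of (k : B)))⁻¹ * g) = f g) ∧
      (if e = 1 then f 1 ≠ 1 else f (σ t) ≠ 1) ∧
      ∀ A x A', l = A ++ x :: A' →
        if x.1 = 1 then f (σ (word φ ((e, b) :: A)))⁻¹ = 1
        else f (σ t * (σ (word φ ((e, b) :: A)))⁻¹) = 1 by
    obtain ⟨f, hf, hf₁, hfl⟩ := this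
    let τ : Z ≀ᵣ G := ⟨f, σ t⟩
    have hlift : ∀ h : H, τ * (RegularWreathProduct.inl.comp (σ.comp of)) (h : B) =
        (RegularWreathProduct.inl.comp (σ.comp of)) (φ h : B) * τ := fun h => by
      refine RegularWreathProduct.ext (funext fun g => ?_) ?_
      · simp [τ, hf]
      · have := congrArg σ (t_mul_of (φ := φ) h)
        simpa [τ] using this
    let Φ := HNNExtension.lift (φ := φ) (RegularWreathProduct.inl.comp (σ.comp of)) τ hlift
    have hΦr : ∀ x, (Φ x).right = σ x := by
      have : (RegularWreathProduct.rightHom : Z ≀ᵣ G →* G).comp Φ = σ := by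
        ext x <;> simp [Φ, τ]
      exact fun x => DFunLike.congr_fun this x
    have hΦof : ∀ b, (Φ (of b)).left = 1 := fun b => by simp [Φ]
    have hΦt : ∀ g, (Φ t).left g = f g := fun g => by simp [Φ, τ]
    have hΦt' : ∀ g, (Φ t⁻¹).left g = (f (σ t * g))⁻¹ := fun g => by simp [Φ, τ]
    refine ⟨Φ, hΦof, ?_⟩
    have h0 : (Φ (word φ l)).left ((σ (t ^ (e : ℤ) * of b))⁻¹) = 1 := by
      refine RegularWreathProduct.left_list_prod_eq_one Φ _ l _ fun A x A' hA => ?_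
      have h1 := hfl A x A' hA
      rw [hΦr, ← mul_inv_rev, ← map_mul]
      rw [word_cons] at h1
      change (Φ (t ^ (x.1 : ℤ) * of x.2)).left (σ (t ^ (e : ℤ) * of b * word φ A))⁻¹ = 1
      rw [map_mul, RegularWreathProduct.mul_left, hΦof]
      rcases Int.units_eq_one_or x.1 with hx | hx
      · simpa [hx, hΦt] using h1
      · rw [if_neg (by rw [hx]; decide)] at h1
        simp only [hx, Units.val_neg, Units.val_one, zpow_neg, zpow_one, Pi.mul_apply, hΦt',
          Pi.one_apply, mul_one, h1, inv_one]
    rw [word_cons, map_mul, RegularWreathProduct.mul_left, Pi.mul_apply, hΦr, mul_one, h0, mul_one,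
      map_mul, RegularWreathProduct.mul_left, hΦof]
    rcases Int.units_eq_one_or e with rfl | rfl
    · simpa [hΦt] using hf₁
    · rw [if_neg (by decide)] at hf₁
      simpa only [Units.val_neg, Units.val_one, zpow_neg, zpow_one, Pi.mul_apply, hΦt',
          Pi.one_apply, mul_one, ne_eq, inv_eq_one] using hf₁
  let KK : Subgroup G := (K.map of).map σ
  have hKmem : ∀ g, g ∈ KK ↔ ∃ k : K, σ (of (k : B)) = g := fun g => by
    simp [KK]
  have hconj : ∀ h : K, (σ t)⁻¹ * σ (of (h : B)) * σ t = σ (of (φ.symm h : B)) := fun h => by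
    rw [equiv_symm_eq_conj]; simp
  rcases Int.units_eq_one_or e with rfl | rfl
  · refine ⟨fun g => if g ∈ KK then z else 1, fun k g => ?_, ?_, fun A x A' hA => ?_⟩
    · have : (σ (of (k : B)))⁻¹ ∈ KK := KK.inv_mem ((hKmem _).2 ⟨k, rfl⟩)
      simp only [KK.mul_mem_cancel_left this]
    · simpa [KK.one_mem] using hz
    · rcases Int.units_eq_one_or x.1 with hx | hx
      · rw [if_pos hx]
        refine if_neg ?_
        intro h
        obtain ⟨k, hk⟩ := (hKmem _).1 (KK.inv_mem h)
        exact hσ₁ A x A' hA ⟨of (k : B), ⟨_, rfl⟩, by simpa using hk⟩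
      · rw [if_neg (by rw [hx]; decide)]
        refine if_neg ?_
        intro h
        obtain ⟨k, hk⟩ := (hKmem _).1 (KK.inv_mem h)
        have hk' : σ (of b) * σ (word φ A) = σ (of (φ.symm k : B)) := by
          rw [← hconj, hk, word_cons]
          simp [mul_assoc]
        by_cases hA' : A = []
        · subst hA'
          have hbH : b ∉ H := fun hb => by
            rw [hA] at hc
            have := (List.isChain_cons_cons.1 hc).1 hb
            rw [hx] at this
            exact absurd (show (1 : ℤˣ) = -1 from this) (by decide)
          exact hσH hbH ⟨_, ⟨_, (φ.symm k).2, rfl⟩, by rw [← hk']; simp [word]⟩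
        · exact hσ₂ A x A' hA hA' ⟨_, ⟨b⁻¹ * φ.symm k, rfl⟩, by
            rw [map_mul, map_mul, ← hk']; simp⟩
  · refine ⟨fun g => if g * (σ t)⁻¹ ∈ KK then z else 1, fun k g => ?_, ?_, fun A x A' hA => ?_⟩
    · have : (σ (of (k : B)))⁻¹ ∈ KK := KK.inv_mem ((hKmem _).2 ⟨k, rfl⟩)
      simp only [mul_assoc, KK.mul_mem_cancel_left this]
    · rw [if_neg (by decide)]
      simpa [KK.one_mem] using hz
    · rcases Int.units_eq_one_or x.1 with hx | hx
      · rw [if_pos hx]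
        refine if_neg ?_
        intro h
        obtain ⟨k, hk⟩ := (hKmem _).1 (KK.inv_mem h)
        have hk' : σ (of b) * σ (word φ A) = σ (of (k : B)) := by
          rw [hk, word_cons]
          simp [mul_assoc]
        by_cases hA' : A = []
        · subst hA'
          have hbK : b ∉ K := fun hb => by
            rw [hA] at hc
            have := (List.isChain_cons_cons.1 hc).1 hb
            rw [hx] at this
            exact absurd (show (-1 : ℤˣ) = 1 from this) (by decide)
          exact hσK hbK ⟨_, ⟨_, k.2, rfl⟩, by rw [← hk']; simp [word]⟩
        · exact hσ₂ A x A' hA hA' ⟨_, ⟨b⁻¹ * k, rfl⟩, by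
            rw [map_mul, map_mul, ← hk']; simp⟩
      · rw [if_neg (by rw [hx]; decide)]
        refine if_neg ?_
        intro h
        obtain ⟨k, hk⟩ := (hKmem _).1 (KK.inv_mem h)
        refine hσ₁ A x A' hA ⟨_, ⟨φ.symm k, rfl⟩, ?_⟩
        rw [← hconj, hk]
        group

/-- An HNN-extension is residually a `C`-group as soon as the elements of the base group can be
separated from the identity and from the associated subgroups by homomorphisms of the extension
to `C`-groups. -/
theorem HNNExtension.residually_of_cSeparates (hroot : IsRootClass C)
    (h1 : ∀ b : B, b ≠ 1 → CSeparates C (of b : HNNExtension B H K φ) {1})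
    (hH : ∀ b ∉ H, CSeparates C (of b : HNNExtension B H K φ) (of '' H))
    (hK : ∀ b ∉ K, CSeparates C (of b : HNNExtension B H K φ) (of '' K)) :
    Residually C (HNNExtension B H K φ) := by
  intro x hx
  suffices ∃ (G : Type u) (_ : Group G) (σ : HNNExtension B H K φ →* G), C G ∧ σ x ≠ 1 by
    obtain ⟨G, _, σ, hG, hσ⟩ := this
    exact ⟨σ.range, _, σ.rangeRestrict, σ.rangeRestrict_surjective, hroot.2.2.1 _ _ hG,
      fun h => hσ (congrArg Subtype.val h)⟩
  obtain ⟨b, l, hc, rfl⟩ := exists_chain_of_mul_word x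
  by_cases hl : l = []
  · subst hl
    have hb : b ≠ 1 := by
      rintro rfl
      exact hx (by simp [word])
    obtain ⟨G, _, σ, hG, hσ⟩ := h1 b hb
    exact ⟨G, _, σ, hG, by simpa [word, eq_comm] using hσ⟩
  · obtain ⟨G, _, σ, hG, hσ⟩ := cSeparates_word hroot hH hK l hl hc
    refine ⟨G, _, σ, hG, fun h => hσ ⟨_, ⟨b⁻¹, rfl⟩, ?_⟩⟩
    rw [map_mul] at h
    rw [map_inv, map_inv, inv_eq_of_mul_eq_one_right h]

end Separation

section SmallShift

theorem exists_hom_of_le_sup {X D : Type*} [Group X] [Group D] (A J S : Subgroup X) [hJ : J.Normal]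
    (hS : S ≤ A ⊔ J) (β : A →* D) (hβ : ∀ a : A, (a : X) ∈ J → β a = 1) :
    ∃ θ : S →* D, ∀ (s : S) (a : A), (a : X)⁻¹ * s ∈ J → θ s = β a := by
  have hex : ∀ s : S, ∃ a : A, (a : X)⁻¹ * s ∈ J := fun s => by
    obtain ⟨a, ha, j, hj, e⟩ := Subgroup.mem_sup_of_normal_right.1 (hS s.2)
    exact ⟨⟨a, ha⟩, by rw [← e]; simpa using hj⟩
  choose c hc using hex
  have huniq : ∀ (s : S) (a : A), (a : X)⁻¹ * s ∈ J → β (c s) = β a := fun s a ha => by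
    have h := hβ (a⁻¹ * c s) (by
      have := J.mul_mem ha (J.inv_mem (hc s))
      simpa [mul_assoc] using this)
    rw [map_mul, map_inv, inv_mul_eq_one] at h
    exact h.symm
  refine ⟨MonoidHom.mk' (fun s => β (c s)) fun s s' => ?_, huniq⟩
  rw [← map_mul]
  refine huniq _ _ ?_
  have := J.mul_mem (hJ.conj_mem' _ (hc s) (c s')) (hc s')
  simpa [mul_assoc] using this

theorem ker_map_subtype_normal {B D : Type*} [Group B] [Group D] {A : Subgroup B} [hA : A.Normal]
    (β : A →* D) (a : B → D)
    (ha : ∀ (x : B) (h h' : A), (h' : B) = x * h * x⁻¹ → a x * β h = β h' * a x) :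
    (β.ker.map A.subtype).Normal := by
  refine ⟨?_⟩
  rintro _ ⟨h, hh, rfl⟩ x
  refine ⟨⟨x * h * x⁻¹, hA.conj_mem _ h.2 x⟩, ?_, rfl⟩
  have := ha x h ⟨x * h * x⁻¹, hA.conj_mem _ h.2 x⟩ rfl
  rw [show β h = 1 from hh, mul_one] at this
  exact right_eq_mul.1 this

namespace RootClass

variable {C : GroupClass.{u}}

theorem range_of_ker_le (hroot : IsRootClass C) (hquot : QuotClosed C) {X G G' : Type u} [Group X]
    [Group G] [Group G'] (f : X →* G) (hG : C G) (g : X →* G') (h : f.ker ≤ g.ker) :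
    C g.range :=
  hroot.1 _ _ (QuotientGroup.quotientKerEquivRange g) (quotient_of_ker_le hroot hquot f hG _ h)

theorem quotient_inf (hroot : IsRootClass C) (hquot : QuotClosed C) {X : Type u} [Group X]
    (N N' : Subgroup X) [N.Normal] [N'.Normal] (h : C (X ⧸ N)) (h' : C (X ⧸ N')) :
    C (X ⧸ N ⊓ N') := by
  refine quotient_of_ker_le hroot hquot ((QuotientGroup.mk' N).prod (QuotientGroup.mk' N'))
    (prod hroot h h') _ fun x hx => ?_
  simpa [MonoidHom.mem_ker] using hx

end RootClass

variable {C : GroupClass.{u}} {B : Type u} [Group B] {H K : Subgroup B} {φ : H ≃* K}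

open HNNExtension in
theorem HNNExtension.exists_hom_of_conj (hroot : IsRootClass C) (hquot : QuotClosed C)
    [hH : H.Normal] [hK : K.Normal] {D : Type u} [Group D] (hD : C D) (β : H →* D) (a₁ a₀ : B →* D)
    (h₁ : ∀ (x : B) (h h' : H), (h' : B) = x * h * x⁻¹ → a₁ x * β h = β h' * a₁ x)
    (h₀ : ∀ (x : B) (k k' : K), (k' : B) = x * k * x⁻¹ →
      a₀ x * β (φ.symm k) = β (φ.symm k') * a₀ x)
    (hL : ∀ h : H, (h : B) ∈ K → β h = 1) (hL' : ∀ k : K, (k : B) ∈ H → β (φ.symm k) = 1)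
    (N : Subgroup B) [hNn : N.Normal] (hN : C (B ⧸ N))
    (hNle : ∀ x ∈ N, x ∈ H ⊔ K →
      ∃ (h : H) (k : K), (h * k : B) = x ∧ β h = 1 ∧ β (φ.symm k) = 1) :
    ∃ (G : Type u) (_ : Group G) (σ : HNNExtension B H K φ →* G), C G ∧
      ∀ b, σ (of b) = 1 →
        ∃ (h : H) (k : K), β h = 1 ∧ β (φ.symm k) = 1 ∧ (h * k : B)⁻¹ * b ∈ N := by
  let σ₀ := QuotientGroup.mk' (H ⊔ K ⊔ N)
  have hσ₀ : σ₀.ker = H ⊔ K ⊔ N := QuotientGroup.ker_mk' _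
  have hmem : ∀ {b : B}, b ∈ H ⊔ K ⊔ N → σ₀ b = 1 := fun {b} hb => by
    rwa [← MonoidHom.mem_ker, hσ₀]
  have hCQ : C (B ⧸ (H ⊔ K ⊔ N)) :=
    RootClass.quotient_of_ker_le hroot hquot (QuotientGroup.mk' N) hN _
      ((QuotientGroup.ker_mk' N).le.trans le_sup_right)
  obtain ⟨θ₁, hθ₁⟩ := exists_hom_of_le_sup H (N ⊔ K) σ₀.ker
    (by rw [hσ₀, sup_assoc, sup_comm K N]) β (fun h hh => by
      obtain ⟨n, hn, k, hk, e⟩ := Subgroup.mem_sup_of_normal_right.1 hh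
      obtain ⟨h', k', e', hh', -⟩ := hNle n hn (by
        rw [eq_mul_inv_of_mul_eq e]
        exact mul_mem (le_sup_left (a := H) h.2) (inv_mem (le_sup_right (b := K) hk)))
      have := hL (h'⁻¹ * h) (by
        rw [← e'] at e
        have : ((h'⁻¹ * h : H) : B) = k' * k := by
          rw [coe_mul, coe_inv, ← e]; group
        rw [this]
        exact mul_mem k'.2 hk)
      rwa [map_mul, map_inv, hh', inv_one, one_mul] at this)
  obtain ⟨θ₀, hθ₀⟩ := exists_hom_of_le_sup K (H ⊔ N) σ₀.ker
    (by rw [hσ₀, ← sup_assoc, sup_comm K H]) (β.comp φ.symm.toMonoidHom) (fun k hk => by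
      obtain ⟨h, hh, n, hn, e⟩ := Subgroup.mem_sup_of_normal_right.1 hk
      obtain ⟨h', k', e', -, hk'⟩ := hNle n hn (by
        rw [eq_inv_mul_of_mul_eq e]
        exact mul_mem (inv_mem (le_sup_left (a := H) hh)) (le_sup_right (b := K) k.2))
      have := hL' (k * k'⁻¹) (by
        rw [← e'] at e
        have : ((k * k'⁻¹ : K) : B) = h * h' := by
          rw [coe_mul, coe_inv, ← e]; group
        rw [this]
        exact mul_mem hh h'.2)
      rw [map_mul, map_mul, map_inv, map_inv, hk', inv_one, mul_one] at this
      exact this)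
  obtain ⟨ρ₁, hρ₁r, hρ₁⟩ := _root_.exists_wreath_lift σ₀ θ₁ a₁ (fun x n n' e => by
    obtain ⟨h, hh, j, hj, e'⟩ := Subgroup.mem_sup_of_normal_right.1
      (show (n : B) ∈ H ⊔ (N ⊔ K) by rw [sup_comm N K, ← sup_assoc]; exact hσ₀.le n.2)
    rw [hθ₁ n ⟨h, hh⟩ (by rw [← e']; simpa using hj),
      hθ₁ n' ⟨x * h * x⁻¹, hH.conj_mem _ hh x⟩ (by
        rw [e, ← e']
        have := (inferInstance : (N ⊔ K).Normal).conj_mem _ hj x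
        simpa [mul_assoc] using this)]
    exact h₁ _ _ _ rfl)
  obtain ⟨ρ₀, hρ₀r, hρ₀⟩ := _root_.exists_wreath_lift σ₀ θ₀ a₀ (fun x n n' e => by
    obtain ⟨h, hh, j, hj, e'⟩ := Subgroup.mem_sup_of_normal_right.1
      (show (n : B) ∈ K ⊔ (H ⊔ N) by rw [← sup_assoc, sup_comm K H]; exact hσ₀.le n.2)
    rw [hθ₀ n ⟨h, hh⟩ (by rw [← e']; simpa using hj),
      hθ₀ n' ⟨x * h * x⁻¹, hK.conj_mem _ hh x⟩ (by
        rw [e, ← e']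
        have := (inferInstance : (H ⊔ N).Normal).conj_mem _ hj x
        simpa [mul_assoc] using this)]
    exact h₀ _ _ _ rfl)
  have hHle : H ≤ H ⊔ K ⊔ N := le_sup_left.trans le_sup_left
  have hKle : K ≤ H ⊔ K ⊔ N := le_sup_right.trans le_sup_left
  obtain ⟨Z, _, hZ, _⟩ := hroot.2.1
  obtain ⟨z, hz⟩ := exists_ne (1 : Z)
  obtain ⟨σ, hσ⟩ := exists_shift φ ρ₀ ρ₁
    (fun h hh => RegularWreathProduct.ext (funext fun g => by
      rw [hρ₀ ⟨h, hmem (hHle hh)⟩ g, hθ₀ _ 1 (by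
        simpa using le_sup_left (b := N) hh)]; simp) (by
      rw [hρ₀r, hmem (hHle hh)]; rfl))
    (fun k hk => RegularWreathProduct.ext (funext fun g => by
      rw [hρ₁ ⟨k, hmem (hKle hk)⟩ g, hθ₁ _ 1 (by
        simpa using le_sup_right (a := N) hk)]; simp) (by
      rw [hρ₁r, hmem (hKle hk)]; rfl))
    (fun h => RegularWreathProduct.ext (funext fun g => by
      rw [hρ₀ ⟨φ h, hmem (hKle (φ h).2)⟩ g, hρ₁ ⟨h, hmem (hHle h.2)⟩ g, hθ₀ _ (φ h) (by simp),
        hθ₁ _ h (by simp)]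
      simp) (by
      rw [hρ₁r, hρ₀r, hmem (hHle h.2), hmem (hKle (φ h).2)])) z hz
  refine ⟨_, _, σ, RootClass.wreath hroot (RootClass.wreath hroot hD hCQ) hZ, fun b hb => ?_⟩
  obtain ⟨e₀, e₁⟩ := hσ b hb
  have hbker : b ∈ σ₀.ker := by
    rw [MonoidHom.mem_ker, ← hρ₁r, e₁]; rfl
  have hb' := hbker
  rw [hσ₀] at hb'
  obtain ⟨x, hx, n, hn, rfl⟩ := Subgroup.mem_sup_of_normal_right.1 hb'
  obtain ⟨h, hh, k, hk, rfl⟩ := Subgroup.mem_sup_of_normal_right.1 hx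
  refine ⟨⟨h, hh⟩, ⟨k, hk⟩, ?_, ?_, by simpa [mul_assoc] using hn⟩
  · rw [← hθ₁ ⟨_, hbker⟩ ⟨h, hh⟩ ?_, ← hρ₁ _ 1, e₁]
    · rfl
    · have : k * n ∈ N ⊔ K := mul_mem (le_sup_right (b := K) hk) (le_sup_left (a := N) hn)
      simpa [mul_assoc] using this
  · rw [← MulEquiv.coe_toMonoidHom, ← MonoidHom.comp_apply, ← hθ₀ ⟨_, hbker⟩ ⟨k, hk⟩ ?_,
      ← hρ₀ _ 1, e₀]
    · rfl
    · have : (k⁻¹ * h * k) * n ∈ H ⊔ N :=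
        mul_mem (le_sup_left (a := H) (hH.conj_mem' _ hh k)) (le_sup_right (b := N) hn)
      simpa [mul_assoc] using this

end SmallShift

section Action

variable {C : GroupClass.{u}} {B : Type u} [Group B] {H K : Subgroup B} {φ : H ≃* K}
  {ψ : MulAut ↥(H ⊓ K)}

theorem conjNormal_mem_autOf {X : Type u} [Group X] (Y : Subgroup X) [Y.Normal] (x : X) :
    MulAut.conjNormal x ∈ autOf X Y :=
  ⟨x, fun y => MulAut.conjNormal_apply x y⟩

theorem IsRestrictionToL.coe_eq (hψ : IsRestrictionToL H K φ ψ) {l : ↥(H ⊓ K)} {h : H}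
    (e : (h : B) = l) : (φ h : B) = ψ l := by
  rw [hψ l, show h = ⟨(l : B), l.2.1⟩ from Subtype.ext e]

theorem IsRestrictionToL.coe_symm_eq (hψ : IsRestrictionToL H K φ ψ) {l : ↥(H ⊓ K)} {k : K}
    (e : (k : B) = l) : (φ.symm k : B) = ψ⁻¹ l := by
  have h := hψ (ψ⁻¹ l)
  rw [MulAut.apply_inv_self, ← e] at h
  rw [Subtype.ext h, MulEquiv.symm_apply_apply]

/-- The restriction to `H ⊓ K` of an element of `𝔘` belongs to `𝔙`. -/
theorem exists_frakV_of_mem_frakU [hH : H.Normal] [hK : K.Normal] (hψ : IsRestrictionToL H K φ ψ)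
    {u : MulAut H} (hu : u ∈ frakU H K φ) :
    ∃ v ∈ frakV H K ψ, ∀ (h : H) (l : ↥(H ⊓ K)), (h : B) = l → (u h : B) = v l := by
  let S : Subgroup (MulAut H) :=
    { carrier := {u | ∃ v ∈ frakV H K ψ, ∀ (h : H) (l : ↥(H ⊓ K)), (h : B) = l → (u h : B) = v l}
      one_mem' := ⟨1, one_mem _, fun h l e => e⟩
      mul_mem' := by
        rintro u u' ⟨v, hv, huv⟩ ⟨v', hv', huv'⟩
        exact ⟨v * v', mul_mem hv hv', fun h l e => huv _ _ (huv' _ _ e)⟩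
      inv_mem' := by
        rintro u ⟨v, hv, huv⟩
        refine ⟨v⁻¹, inv_mem hv, fun h l e => ?_⟩
        have := huv ⟨v⁻¹ l, (v⁻¹ l).2.1⟩ (v⁻¹ l) rfl
        rw [MulAut.apply_inv_self, ← e] at this
        rw [← Subtype.ext this, MulAut.inv_apply_self] }
  suffices frakU H K φ ≤ S from this hu
  refine sup_le ?_ ?_
  · rintro u ⟨x, hx⟩
    refine ⟨MulAut.conjNormal x, Subgroup.mem_sup_left (conjNormal_mem_autOf _ x),
      fun h l e => ?_⟩
    rw [hx, MulAut.conjNormal_apply, e]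
  · rintro _ ⟨u, ⟨x, hx⟩, rfl⟩
    have hψV : ψ ∈ frakV H K ψ := Subgroup.mem_sup_right (Subgroup.mem_zpowers ψ)
    refine ⟨ψ⁻¹ * MulAut.conjNormal x * ψ, mul_mem (mul_mem (inv_mem hψV)
      (Subgroup.mem_sup_left (conjNormal_mem_autOf _ x))) hψV, fun h l e => ?_⟩
    refine hψ.coe_symm_eq (l := MulAut.conjNormal x (ψ l)) ?_
    rw [MulAut.conjNormal_apply, ← hψ.coe_eq e]
    exact hx _

/-- The action of `B` on `H` by conjugation. -/
def conjLeft [H.Normal] (φ : H ≃* K) : B →* frakU H K φ :=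
  (MulAut.conjNormal : B →* MulAut H).codRestrict _ fun x =>
    Subgroup.mem_sup_left (conjNormal_mem_autOf H x)

/-- The action of `B` on `H` obtained from the action on `K` by conjugation. -/
def conjRight [K.Normal] (φ : H ≃* K) : B →* frakU H K φ :=
  ((autConjHom φ).comp (MulAut.conjNormal : B →* MulAut K)).codRestrict _ fun x =>
    Subgroup.mem_sup_right (Subgroup.mem_map_of_mem _ (conjNormal_mem_autOf K x))

theorem SemidirectProduct.map_inr_mul_map_inl {N A G : Type*} [Group N] [Group A] [Group G]
    {f : A →* MulAut N} (F : N ⋊[f] A →* G) (a : A) (n : N) :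
    F (inr a) * F (inl n) = F (inl (f a n)) * F (inr a) := by
  rw [← map_mul, ← map_mul, inl_aut]
  simp

variable {G : Type u} [Group G] (F : H ⋊[(frakU H K φ).subtype] (frakU H K φ) →* G)

theorem map_conjLeft_mul [H.Normal] (x : B) (h h' : H) (e : (h' : B) = x * h * x⁻¹) :
    F (SemidirectProduct.inr (conjLeft φ x)) * F (SemidirectProduct.inl h) =
      F (SemidirectProduct.inl h') * F (SemidirectProduct.inr (conjLeft φ x)) := by
  rw [SemidirectProduct.map_inr_mul_map_inl]
  congr 3
  exact Subtype.ext ((MulAut.conjNormal_apply x h).trans e.symm)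

theorem map_conjRight_mul [K.Normal] (x : B) (k k' : K) (e : (k' : B) = x * k * x⁻¹) :
    F (SemidirectProduct.inr (conjRight φ x)) * F (SemidirectProduct.inl (φ.symm k)) =
      F (SemidirectProduct.inl (φ.symm k')) * F (SemidirectProduct.inr (conjRight φ x)) := by
  rw [SemidirectProduct.map_inr_mul_map_inl]
  congr 3
  have : MulAut.conjNormal x k = k' := Subtype.ext ((MulAut.conjNormal_apply x k).trans e.symm)
  simp [conjRight, autConjHom, this]

/-- The kernel of `F` on `H`, as a subgroup of `B`. -/
def kerLeft : Subgroup B := (F.comp SemidirectProduct.inl).ker.map H.subtype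

/-- The image under `φ` of the kernel of `F` on `H`, as a subgroup of `B`. -/
def kerRight : Subgroup B :=
  ((F.comp SemidirectProduct.inl).comp φ.symm.toMonoidHom).ker.map K.subtype

theorem coe_mem_kerLeft {h : H} : (h : B) ∈ kerLeft F ↔ F (SemidirectProduct.inl h) = 1 :=
  Subgroup.mem_map_iff_mem (Subgroup.subtype_injective H)

theorem coe_mem_kerRight {k : K} :
    (k : B) ∈ kerRight F ↔ F (SemidirectProduct.inl (φ.symm k)) = 1 :=
  Subgroup.mem_map_iff_mem (Subgroup.subtype_injective K)

theorem kerLeft_le : kerLeft F ≤ H := Subgroup.map_subtype_le _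

theorem kerRight_le : kerRight F ≤ K := Subgroup.map_subtype_le _

instance [H.Normal] : (kerLeft F).Normal :=
  ker_map_subtype_normal _ (fun x => F (SemidirectProduct.inr (conjLeft φ x)))
    (map_conjLeft_mul F)

instance [K.Normal] : (kerRight F).Normal :=
  ker_map_subtype_normal _ (fun x => F (SemidirectProduct.inr (conjRight φ x)))
    (map_conjRight_mul F)

theorem map_inl_normal (T : Subgroup H) [T.Normal]
    (hT : ∀ u ∈ frakU H K φ, ∀ h ∈ T, u h ∈ T) :
    (T.map (SemidirectProduct.inl :
      H →* H ⋊[(frakU H K φ).subtype] (frakU H K φ))).Normal := by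
  refine ⟨?_⟩
  rintro _ ⟨l, hl, rfl⟩ x
  refine ⟨x.left * (x.right : MulAut H) l * x.left⁻¹,
    (inferInstance : T.Normal).conj_mem _ (hT _ x.right.2 _ hl) _, ?_⟩
  ext <;> simp

theorem subgroupOf_invariant [H.Normal] [K.Normal] (hψ : IsRestrictionToL H K φ ψ)
    (u) (hu : u ∈ frakU H K φ) (h) (hh : h ∈ K.subgroupOf H) : u h ∈ K.subgroupOf H := by
  obtain ⟨v, -, huv⟩ := exists_frakV_of_mem_frakU hψ hu
  rw [Subgroup.mem_subgroupOf, huv h ⟨h, h.2, hh⟩ rfl]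
  exact (v _).2.2

end Action

section SmallKernel

variable {C : GroupClass.{u}} {B : Type u} [Group B] {H K : Subgroup B} {φ : H ≃* K}
  {ψ : MulAut ↥(H ⊓ K)} {G : Type u} [Group G]
  (F : H ⋊[(frakU H K φ).subtype] (frakU H K φ) →* G)

theorem exists_normal_inf_le (hroot : IsRootClass C) (hquot : QuotClosed C) [H.Normal] [K.Normal]
    (hqr : QuasiRegular C B (H ⊔ K)) (hG : C G) :
    ∃ N : Subgroup B, ∃ _ : N.Normal, C (B ⧸ N) ∧
      ∀ x ∈ N, x ∈ H ⊔ K → x ∈ kerLeft F ⊔ kerRight F := by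
  let π := QuotientGroup.mk' (kerLeft F ⊔ kerRight F)
  let γ : ↥(H ⊔ K) →* _ := π.comp (H ⊔ K).subtype
  have hπ : ∀ b, b ∈ kerLeft F ⊔ kerRight F → π b = 1 := fun b hb =>
    (QuotientGroup.eq_one_iff b).2 hb
  have h1 : C (π.comp H.subtype).range :=
    RootClass.range_of_ker_le hroot hquot (F.comp SemidirectProduct.inl) hG _ fun h hh =>
      hπ _ (Subgroup.mem_sup_left ((coe_mem_kerLeft F).2 hh))
  have h2 : C (π.comp K.subtype).range :=
    RootClass.range_of_ker_le hroot hquot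
      ((F.comp SemidirectProduct.inl).comp φ.symm.toMonoidHom) hG _ fun h hh =>
      hπ _ (Subgroup.mem_sup_right ((coe_mem_kerRight F).2 hh))
  have h3 : γ.range = (π.comp H.subtype).range ⊔ (π.comp K.subtype).range := by
    simp only [γ, MonoidHom.range_comp, Subgroup.range_subtype, Subgroup.map_sup]
  have h4 : (π.comp H.subtype).range.Normal := by
    rw [MonoidHom.range_comp, Subgroup.range_subtype]
    exact Subgroup.Normal.map inferInstance _ (QuotientGroup.mk'_surjective _)
  have h5 : C γ.range := by
    rw [h3]
    exact RootClass.sup hroot hquot _ _ h1 h2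
  obtain ⟨N, ⟨hN, hNC⟩, hle⟩ := hqr γ.ker
    ⟨inferInstance, hroot.1 _ _ (QuotientGroup.quotientKerEquivRange γ).symm h5⟩
  refine ⟨N, hN, hNC, fun x hx hx' => ?_⟩
  have : (⟨x, hx'⟩ : ↥(H ⊔ K)) ∈ γ.ker := hle hx
  exact (QuotientGroup.eq_one_iff x).1 this

open HNNExtension in
/-- Existence of homomorphisms of the HNN-extension to `C`-groups whose kernel is small on `B`,
up to `H ⊓ K`. -/
theorem HNNExtension.exists_hom_ker_le (hroot : IsRootClass C) (hquot : QuotClosed C)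
    [hH : H.Normal] [hK : K.Normal] (hψ : IsRestrictionToL H K φ ψ)
    (hqr : QuasiRegular C B (H ⊔ K)) (hG : C G)
    (N' : Subgroup B) [hN' : N'.Normal] (hN'C : C (B ⧸ N')) :
    ∃ N : Subgroup B, ∃ _ : N.Normal, N ≤ N' ∧
      (∀ x ∈ N, x ∈ H ⊔ K → x ∈ kerLeft F ⊔ kerRight F) ∧
      ∃ (P : Type u) (_ : Group P) (σ : HNNExtension B H K φ →* P), C P ∧
        ∀ b, σ (of b) = 1 → b ∈ (H ⊓ K) ⊔ (kerLeft F ⊔ kerRight F ⊔ N) := by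
  obtain ⟨N₁, hN₁, hN₁C, hN₁le⟩ := exists_normal_inf_le F hroot hquot hqr hG
  have hNle : ∀ x ∈ N₁ ⊓ N', x ∈ H ⊔ K → x ∈ kerLeft F ⊔ kerRight F := fun x hx =>
    hN₁le x hx.1
  refine ⟨N₁ ⊓ N', inferInstance, inf_le_right, hNle, ?_⟩
  let X := H ⋊[(frakU H K φ).subtype] (frakU H K φ)
  let L : Subgroup X := (K.subgroupOf H).map SemidirectProduct.inl
  have hL : L.Normal := map_inl_normal _ (subgroupOf_invariant hψ)
  let F' := QuotientGroup.mk' (F.ker ⊔ L)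
  have hF : ∀ x, F x = 1 → F' x = 1 := fun x hx =>
    (QuotientGroup.eq_one_iff x).2 (Subgroup.mem_sup_left hx)
  have hF'L : ∀ h : H, (h : B) ∈ K → F' (SemidirectProduct.inl h) = 1 := fun h hh =>
    (QuotientGroup.eq_one_iff _).2 (Subgroup.mem_sup_right (Subgroup.mem_map_of_mem _ hh))
  have hF' : ∀ h : H, F' (SemidirectProduct.inl h) = 1 → ∃ m l : H, h = m * l ∧ (l : B) ∈ K ∧
      F (SemidirectProduct.inl m) = 1 := fun h hh => by
    obtain ⟨y, hy, _, ⟨l, hl, rfl⟩, e⟩ :=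
      Subgroup.mem_sup_of_normal_right.1 ((QuotientGroup.eq_one_iff _).1 hh)
    refine ⟨h * l⁻¹, l, by group, hl, ?_⟩
    rw [map_mul, ← e]
    simpa using hy
  obtain ⟨P, _, σ, hP, hσ⟩ := exists_hom_of_conj hroot hquot
    (RootClass.quotient_of_ker_le hroot hquot F hG (F.ker ⊔ L) le_sup_left)
    (F'.comp SemidirectProduct.inl) (F'.comp (SemidirectProduct.inr.comp (conjLeft φ)))
    (F'.comp (SemidirectProduct.inr.comp (conjRight φ))) (map_conjLeft_mul F')
    (map_conjRight_mul F') hF'L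
    (fun k hk => hF'L _ (by
      rw [hψ.coe_symm_eq (l := ⟨k, hk, k.2⟩) rfl]
      exact (ψ⁻¹ _).2.2)) (N₁ ⊓ N')
    (RootClass.quotient_inf hroot hquot N₁ N' hN₁C hN'C) (fun x hx hx' => by
      obtain ⟨y, hy, z, hz, e⟩ := Subgroup.mem_sup_of_normal_right.1 (hNle x hx hx')
      exact ⟨⟨y, kerLeft_le F hy⟩, ⟨z, kerRight_le F hz⟩, e,
        hF _ ((coe_mem_kerLeft F).1 hy), hF _ ((coe_mem_kerRight F).1 hz)⟩)
  refine ⟨P, _, σ, hP, fun b hb => ?_⟩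
  obtain ⟨h, k, hh, hk, hn⟩ := hσ b hb
  obtain ⟨m, l, rfl, hl, hm⟩ := hF' h hh
  obtain ⟨m', l', e, hl', hm'⟩ := hF' (φ.symm k) hk
  rw [MulEquiv.symm_apply_eq] at e
  subst e
  set S := (H ⊓ K) ⊔ (kerLeft F ⊔ kerRight F ⊔ (N₁ ⊓ N'))
  have i1 : ((m : H) : B) ∈ S := Subgroup.mem_sup_right
    (Subgroup.mem_sup_left (Subgroup.mem_sup_left ((coe_mem_kerLeft F).2 hm)))
  have i2 : ((l : H) : B) ∈ S := Subgroup.mem_sup_left ⟨l.2, hl⟩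
  have i3 : ((φ m' : K) : B) ∈ S := Subgroup.mem_sup_right
    (Subgroup.mem_sup_left (Subgroup.mem_sup_right ((coe_mem_kerRight F).2 (by simpa using hm'))))
  have i4 : ((φ l' : K) : B) ∈ S := Subgroup.mem_sup_left (by
    rw [hψ.coe_eq (l := ⟨l', l'.2, hl'⟩) rfl]
    exact (ψ _).2)
  have i5 := Subgroup.mem_sup_right (S := H ⊓ K) (Subgroup.mem_sup_right
    (S := kerLeft F ⊔ kerRight F) hn)
  have := mul_mem (mul_mem (mul_mem i1 i2) (mul_mem i3 i4)) i5
  simpa [mul_assoc] using this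

open HNNExtension in
theorem HNNExtension.cSeparates_of_notMem (hroot : IsRootClass C) (hquot : QuotClosed C)
    [hH : H.Normal] [hK : K.Normal] (hψ : IsRestrictionToL H K φ ψ)
    (hqr : QuasiRegular C B (H ⊔ K)) (hU : C ↥(frakU H K φ)) (A : Subgroup B) (hA : H ⊓ K ≤ A)
    (α : H →* B)
    (hα : ∀ N' : Subgroup B, A ≤ N' → ∀ h, α h ∈ N' → (h : B) ∈ N' ∧ (φ h : B) ∈ N')
    [hAn : A.Normal] (hBA : Residually C (B ⧸ A)) {b : B} (hb : b ∉ A) :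
    CSeparates C (of b : HNNExtension B H K φ) (of '' A) := by
  obtain ⟨Q, _, f, -, hQ, hf⟩ := hBA (b : B ⧸ A) (by rwa [ne_eq, QuotientGroup.eq_one_iff])
  let g : B →* Q := f.comp (QuotientGroup.mk' A)
  have hAg : A ≤ g.ker := fun a ha => by
    simp [g, MonoidHom.mem_ker, (QuotientGroup.eq_one_iff a).2 ha]
  obtain ⟨G, _, F, hG, hF⟩ := RootClass.exists_semidirect_hom hroot (frakU H K φ) hU
    (g.comp α) hQ
  obtain ⟨N, _, hNle, -, P, _, σ, hP, hσ⟩ := exists_hom_ker_le F hroot hquot hψ hqr hG g.ker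
    (RootClass.quotient_of_ker_le hroot hquot g hQ _ le_rfl)
  refine ⟨P, _, σ, hP, ?_⟩
  rintro ⟨_, ⟨a, ha, rfl⟩, e⟩
  have h1 := hσ (a⁻¹ * b) (by rw [map_mul, map_mul, map_inv, map_inv, e, inv_mul_cancel])
  have h2 : (H ⊓ K) ⊔ (kerLeft F ⊔ kerRight F ⊔ N) ≤ g.ker := by
    refine sup_le (hA.trans hAg) (sup_le (sup_le ?_ ?_) hNle)
    · intro x hx
      obtain ⟨h, rfl⟩ : ∃ h : H, (h : B) = x := ⟨⟨x, kerLeft_le F hx⟩, rfl⟩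
      exact (hα _ hAg h (hF _ ((coe_mem_kerLeft F).1 hx))).1
    · intro x hx
      obtain ⟨k, rfl⟩ : ∃ k : K, (k : B) = x := ⟨⟨x, kerRight_le F hx⟩, rfl⟩
      have := (hα _ hAg _ (hF _ ((coe_mem_kerRight F).1 hx))).2
      rwa [MulEquiv.apply_symm_apply] at this
  have h3 := mul_mem (hAg ha) (h2 h1)
  rw [mul_inv_cancel_left] at h3
  exact hf h3

end SmallKernel

section Intersection

variable {C : GroupClass.{u}} {B : Type u} [Group B] {H K : Subgroup B} {φ : H ≃* K}
  {ψ : MulAut ↥(H ⊓ K)} {G D : Type u} [Group G] [Group D]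
  (F : H ⋊[(frakU H K φ).subtype] (frakU H K φ) →* G)
  (FV : ↥(H ⊓ K) ⋊[(frakV H K ψ).subtype] (frakV H K ψ) →* D)

open SemidirectProduct in
theorem map_inl_apply_eq_one {v : MulAut ↥(H ⊓ K)} (hv : v ∈ frakV H K ψ) {l : ↥(H ⊓ K)}
    (hl : FV (inl l) = 1) : FV (inl (v l)) = 1 := by
  have := map_inr_mul_map_inl FV ⟨v, hv⟩ l
  rw [hl, mul_one] at this
  exact right_eq_mul.1 this

open HNNExtension SemidirectProduct in
/-- The action on `H ⊓ K` of the HNN-extension. -/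
theorem HNNExtension.exists_action [hH : H.Normal] [hK : K.Normal]
    (hψ : IsRestrictionToL H K φ ψ) :
    ∃ a : HNNExtension B H K φ →* frakV H K ψ,
      (∀ x, (a (of x) : MulAut ↥(H ⊓ K)) = MulAut.conjNormal x) ∧
      (a t : MulAut ↥(H ⊓ K)) = ψ := by
  let c : B →* frakV H K ψ :=
    (MulAut.conjNormal : B →* MulAut ↥(H ⊓ K)).codRestrict _ fun x =>
      Subgroup.mem_sup_left (conjNormal_mem_autOf _ x)
  refine ⟨lift c ⟨ψ, Subgroup.mem_sup_right (Subgroup.mem_zpowers ψ)⟩ fun h => ?_,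
    fun x => by rw [lift_of]; rfl, by rw [lift_t]⟩
  refine Subtype.ext (MulEquiv.ext fun l => Subtype.ext ?_)
  change ((ψ (MulAut.conjNormal (h : B) l) : ↥(H ⊓ K)) : B) =
    (MulAut.conjNormal (φ h : B) (ψ l) : ↥(H ⊓ K))
  rw [MulAut.conjNormal_apply, ← hψ.coe_eq (l := l) (h := ⟨l, l.2.1⟩) rfl,
    ← hψ.coe_eq (h := h * ⟨l, l.2.1⟩ * h⁻¹) (by rw [MulAut.conjNormal_apply]; rfl)]
  simp

open HNNExtension SemidirectProduct in
theorem HNNExtension.cSeparates_of_mem_inf (hroot : IsRootClass C) (hquot : QuotClosed C)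
    [hH : H.Normal] [hK : K.Normal] (hψ : IsRestrictionToL H K φ ψ)
    (hqr : QuasiRegular C B (H ⊔ K)) (hG : C G) (hD : C D)
    (hF : ∀ (h : H) (l : ↥(H ⊓ K)), (h : B) = l → (F (inl h) = 1 ↔ FV (inl l) = 1))
    {b : ↥(H ⊓ K)} (hb : FV (inl b) ≠ 1) :
    CSeparates C (of (b : B) : HNNExtension B H K φ) {1} := by
  obtain ⟨N₀, _, hN₀, -⟩ := exists_normal_inf_le F hroot hquot hqr hG
  obtain ⟨N, _, -, hNle, P, _, σ, hP, hσ⟩ :=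
    exists_hom_ker_le F hroot hquot hψ hqr hG N₀ hN₀
  set R := kerLeft F ⊔ kerRight F ⊔ N
  have hψV : ψ ∈ frakV H K ψ := Subgroup.mem_sup_right (Subgroup.mem_zpowers ψ)
  have hRH : ∀ h : H, (h : B) ∈ R → F (inl h) = 1 := fun h hh => by
    have hMM : kerLeft F ⊔ kerRight F ≤ H ⊔ K := sup_le_sup (kerLeft_le F) (kerRight_le F)
    have h1 : (h : B) ∈ kerLeft F ⊔ kerRight F := by
      obtain ⟨y, hy, n, hn, e⟩ := Subgroup.mem_sup_of_normal_right.1 hh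
      rw [← e]
      refine mul_mem hy (hNle n hn ?_)
      rw [eq_inv_mul_of_mul_eq e]
      exact mul_mem (inv_mem (hMM hy)) (Subgroup.mem_sup_left h.2)
    obtain ⟨m, hm, m', hm', e⟩ := Subgroup.mem_sup_of_normal_right.1 h1
    have hm'H : m' ∈ H := by
      rw [eq_inv_mul_of_mul_eq e]
      exact mul_mem (inv_mem (kerLeft_le F hm)) h.2
    let l : ↥(H ⊓ K) := ⟨m', hm'H, kerRight_le F hm'⟩
    have h2 : F (inl (φ.symm ⟨m', l.2.2⟩)) = 1 := (coe_mem_kerRight F).1 hm'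
    rw [hF _ (ψ⁻¹ l) (hψ.coe_symm_eq rfl)] at h2
    have h3 := map_inl_apply_eq_one FV hψV h2
    rw [MulAut.apply_inv_self, ← hF ⟨m', hm'H⟩ l rfl] at h3
    have h4 : h = ⟨m, kerLeft_le F hm⟩ * ⟨m', hm'H⟩ := Subtype.ext e.symm
    rw [h4, map_mul, map_mul, h3, mul_one]
    exact (coe_mem_kerLeft F).1 hm
  obtain ⟨θ, hθ⟩ := exists_hom_of_le_sup (H ⊓ K) R (σ.comp of).ker hσ (FV.comp inl)
    fun l hl => (hF ⟨l, l.2.1⟩ l rfl).1 (hRH _ hl)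
  obtain ⟨a, ha, hat⟩ := exists_action (ψ := ψ) (φ := φ) hψ
  obtain ⟨ρ, hρr, hρ⟩ := exists_wreath_lift σ θ (FV.comp (inr.comp a))
    (fun x n n' e => by
      obtain ⟨l, hl, r, hr, e'⟩ := Subgroup.mem_sup_of_normal_right.1 (hσ n n.2)
      rw [hθ n ⟨l, hl⟩ (by rw [← e']; simpa using hr),
        hθ n' (MulAut.conjNormal x ⟨l, hl⟩) (by
          rw [e, ← e', MulAut.conjNormal_apply]
          have := (inferInstance : R.Normal).conj_mem _ hr x
          simpa [mul_assoc] using this)]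
      have := map_inr_mul_map_inl FV (a (of x)) ⟨l, hl⟩
      rw [Subgroup.subtype_apply, ha] at this
      exact this)
    (fun h n n' e e₂ => by
      obtain ⟨l, hl, r, hr, e'⟩ := Subgroup.mem_sup_of_normal_right.1 (hσ n n.2)
      have hrH : r ∈ H := by
        rw [eq_inv_mul_of_mul_eq e', e]
        exact mul_mem (inv_mem hl.1) h.2
      have hh : h = ⟨l, hl.1⟩ * ⟨r, hrH⟩ := Subtype.ext (by rw [← e, ← e']; rfl)
      rw [hθ n ⟨l, hl⟩ (by rw [← e']; simpa using hr),
        hθ n' (ψ ⟨l, hl⟩) (by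
          rw [e₂, hh, map_mul, Subgroup.coe_mul, hψ.coe_eq (l := ⟨l, hl⟩) rfl,
            inv_mul_cancel_left]
          exact Subgroup.mem_sup_left (Subgroup.mem_sup_right ((coe_mem_kerRight F).2 (by
            rw [MulEquiv.symm_apply_apply]
            exact hRH _ hr))))]
      have := map_inr_mul_map_inl FV (a t) ⟨l, hl⟩
      rw [Subgroup.subtype_apply, hat] at this
      exact this)
  by_cases hσb : σ (of (b : B)) = 1
  · refine ⟨_, _, ρ, RootClass.wreath hroot hD hP, ?_⟩
    rintro ⟨_, rfl, e⟩
    rw [map_one] at e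
    have h1 := hρ ⟨b, hσb⟩ 1
    rw [hθ _ b (by simp), ← e] at h1
    exact hb h1.symm
  · exact ⟨P, _, σ, hP, by rintro ⟨_, rfl, e⟩; exact hσb (by rw [← e, map_one])⟩

open SemidirectProduct in
theorem exists_hom_of_quotient_mem (hroot : IsRootClass C) (hquot : QuotClosed C)
    [hH : H.Normal] [hK : K.Normal] (hψ : IsRestrictionToL H K φ ψ) (hU : C ↥(frakU H K φ))
    (hHL : C (↥H ⧸ (H ⊓ K).subgroupOf H)) (hD : C D) :
    ∃ (G : Type u) (_ : Group G) (F : H ⋊[(frakU H K φ).subtype] (frakU H K φ) →* G), C G ∧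
      ∀ (h : H) (l : ↥(H ⊓ K)), (h : B) = l → (F (inl h) = 1 ↔ FV (inl l) = 1) := by
  obtain ⟨G₁, _, F₁, hG₁, hF₁⟩ := RootClass.exists_semidirect_hom hroot (frakU H K φ) hU
    (QuotientGroup.mk' ((H ⊓ K).subgroupOf H)) hHL
  have hker : ∀ x ∈ (F₁.prod rightHom).ker, (x.left : B) ∈ H ⊓ K ∧ x.right = 1 := fun x hx => by
    obtain ⟨h1, h2⟩ : F₁ x = 1 ∧ x.right = 1 := by simpa [MonoidHom.mem_ker] using hx
    have hx' : inl x.left = x := SemidirectProduct.ext rfl h2.symm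
    have h3 := hF₁ x.left (by rw [hx', h1])
    exact ⟨(QuotientGroup.eq_one_iff (N := (H ⊓ K).subgroupOf H) x.left).1 h3, h2⟩
  obtain ⟨G₂, _, F₂, hG₂, hF₂⟩ := RootClass.exists_hom_of_hom_ker hroot (F₁.prod rightHom)
    (RootClass.prod hroot hG₁ hU)
    (MonoidHom.mk' (fun x => FV (inl ⟨x.1.left, (hker x x.2).1⟩)) fun x y => by
      rw [← map_mul, ← map_mul]
      congr 2
      ext
      simp [(hker x x.2).2]) hD
  let T : Subgroup H := ((FV.comp inl).ker.map (H ⊓ K).subtype).subgroupOf H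
  have hTmem : ∀ (h : H) (l : ↥(H ⊓ K)), (h : B) = l → (h ∈ T ↔ FV (inl l) = 1) :=
    fun h l e => by
      rw [Subgroup.mem_subgroupOf, e]
      exact Subgroup.mem_map_iff_mem (Subgroup.subtype_injective _)
  have hTL : ∀ h ∈ T, (h : B) ∈ H ⊓ K := fun h hh => Subgroup.map_subtype_le _ hh
  have hTinv : ∀ u ∈ frakU H K φ, ∀ h ∈ T, u h ∈ T := fun u hu h hh => by
    obtain ⟨v, hv, huv⟩ := exists_frakV_of_mem_frakU hψ hu
    have e := huv h ⟨h, hTL h hh⟩ rfl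
    exact (hTmem _ _ e).2 (map_inl_apply_eq_one FV hv ((hTmem h ⟨h, hTL h hh⟩ rfl).1 hh))
  have hTn : T.Normal := ⟨fun h hh x => by
    have := hTinv _ (conjLeft φ (x : B)).2 h hh
    have e : ((conjLeft φ (x : B) : frakU H K φ) : MulAut H) h = x * h * x⁻¹ :=
      Subtype.ext (MulAut.conjNormal_apply _ _)
    rwa [e] at this⟩
  have hTX := map_inl_normal T hTinv
  refine ⟨_, _, QuotientGroup.mk' (T.map inl), RootClass.quotient_of_ker_le hroot hquot F₂ hG₂ _ ?_,
    fun h l e => ?_⟩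
  · intro x hx
    obtain ⟨hx', hxV⟩ := hF₂ x hx
    exact ⟨x.left, (hTmem _ _ rfl).2 hxV, SemidirectProduct.ext rfl (hker x hx').2.symm⟩
  · rw [← hTmem h l e, QuotientGroup.mk'_apply, QuotientGroup.eq_one_iff,
      Subgroup.mem_map_iff_mem inl_injective]

end Intersection

theorem statement_4 (C : GroupClass.{u}) (hroot : IsRootClass C) (hquot : QuotClosed C)
    {B : Type u} [Group B] (H K : Subgroup B) (φ : H ≃* K)
    (hH : H.Normal) (hK : K.Normal)
    (ψ : MulAut ↥(H ⊓ K)) (hψ : IsRestrictionToL H K φ ψ)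
    (halphabeta : (C (↥H ⧸ (H ⊓ K).subgroupOf H) ∨
      ∃ (G : Type u) (_ : Group G) (σ : B →* G), Function.Surjective σ ∧ C G ∧
        Function.Injective (σ.comp (H ⊓ K).subtype)))
    (hU : C ↥(frakU H K φ)) (hV : C ↥(frakV H K ψ))
    (hqr : QuasiRegular C B (H ⊔ K))
    (hBH : Residually C (B ⧸ H)) (hBK : Residually C (B ⧸ K)) :
    Residually C (HNNExtension B H K φ) ↔ Residually C B := by
  constructor
  · intro h b hb
    obtain ⟨G, _, f, -, hG, hf⟩ := h (HNNExtension.of b) fun e =>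
      hb (HNNExtension.of_injective (φ := φ) (e.trans (map_one _).symm))
    exact ⟨_, _, (f.comp HNNExtension.of).rangeRestrict, MonoidHom.rangeRestrict_surjective _,
      hroot.2.2.1 _ _ hG, fun e => hf (congrArg Subtype.val e)⟩
  intro hB
  have hsepH : ∀ b ∉ H, CSeparates C (HNNExtension.of b : HNNExtension B H K φ)
      (HNNExtension.of '' H) := fun b hb =>
    HNNExtension.cSeparates_of_notMem hroot hquot hψ hqr hU H inf_le_left
      (K.subtype.comp φ.toMonoidHom) (fun N' hN' h hh => ⟨hN' h.2, hh⟩) hBH hb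
  have hsepK : ∀ b ∉ K, CSeparates C (HNNExtension.of b : HNNExtension B H K φ)
      (HNNExtension.of '' K) := fun b hb =>
    HNNExtension.cSeparates_of_notMem hroot hquot hψ hqr hU K inf_le_right
      H.subtype (fun N' hN' h hh => ⟨hh, hN' (φ h).2⟩) hBK hb
  refine HNNExtension.residually_of_cSeparates hroot (fun b hb => ?_) hsepH hsepK
  have hone : ∀ A : Subgroup B, ({1} : Set (HNNExtension B H K φ)) ⊆ HNNExtension.of '' A :=
    fun A => Set.singleton_subset_iff.2 ⟨1, A.one_mem, map_one _⟩
  by_cases hbH : b ∈ H; swap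
  · obtain ⟨G, _, σ, hG, hσ⟩ := hsepH b hbH
    exact ⟨G, _, σ, hG, fun h => hσ (Set.image_mono (hone H) h)⟩
  by_cases hbK : b ∈ K; swap
  · obtain ⟨G, _, σ, hG, hσ⟩ := hsepK b hbK
    exact ⟨G, _, σ, hG, fun h => hσ (Set.image_mono (hone K) h)⟩
  rcases halphabeta with hHL | ⟨G, _, σ, -, hG, hσ⟩
  · obtain ⟨D, _, f, -, hD, hf⟩ := hB b hb
    obtain ⟨D', _, FV, hD', hFV⟩ := RootClass.exists_semidirect_hom hroot (frakV H K ψ) hV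
      (f.comp (H ⊓ K).subtype) hD
    obtain ⟨G, _, F, hG, hF⟩ := exists_hom_of_quotient_mem FV hroot hquot hψ hU hHL hD'
    exact HNNExtension.cSeparates_of_mem_inf F FV hroot hquot hψ hqr hG hD' hF
      (b := ⟨b, hbH, hbK⟩) fun h => hf (hFV _ h)
  · obtain ⟨G', _, F, hG', hF⟩ := RootClass.exists_semidirect_hom hroot (frakU H K φ) hU
      (σ.comp H.subtype) hG
    refine HNNExtension.cSeparates_of_mem_inf F (MonoidHom.id _) hroot hquot hψ hqr hG'
      (RootClass.semidirectProduct hroot _ (RootClass.of_injective hroot _ hσ hG) hV)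
      (fun h l e => ⟨fun h1 => ?_, fun h1 => ?_⟩) (b := ⟨b, hbH, hbK⟩) fun h => ?_
    · have : l = 1 := hσ (by
        rw [map_one, MonoidHom.comp_apply, Subgroup.subtype_apply, ← e]
        exact hF h h1)
      rw [this, map_one, map_one]
    · have h2 : l = 1 := SemidirectProduct.inl_injective (h1.trans (map_one _).symm)
      have : h = 1 := Subtype.ext (by rw [e, h2]; rfl)
      rw [this, map_one, map_one]
    · have h2 := SemidirectProduct.inl_injective (h.trans (map_one _).symm)
      exact hb (congrArg Subtype.val h2)
end

section
/- Suppose the HNN-extension 𝔼 = ⟨B, t; t⁻¹Ht = K, φ⟩ satisfies condition (*), 𝒞 is a root class of groups closed under taking quotient groups, and at least one of the following holds: (α) H/L ∈ 𝒞; (β) there exists a homomorphism of B onto a group from 𝒞 acting injectively on L. Suppose also that 𝔘 = 𝔥 or 𝔘 = 𝔎, that 𝔙 ∈ 𝒞, and that B is 𝒞-quasi-regular with respect to HK. Then 𝔼 is residually a 𝒞-group if and only if the groups B, B/H, and B/K are residually 𝒞-groups. -/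
universe u

open Subgroup

namespace IsRootClass

variable {C : GroupClass.{u}}

theorem of_injective (hC : IsRootClass C) {X Y : Type u} [Group X] [Group Y] (f : X →* Y)
    (hf : Function.Injective f) (hY : C Y) : C X :=
  hC.1 _ _ (MonoidHom.ofInjective hf).symm (hC.2.2.1 Y f.range hY)

theorem quotient_ker (hC : IsRootClass C) {X Y : Type u} [Group X] [Group Y] (f : X →* Y)
    (hY : C Y) : C (X ⧸ f.ker) :=
  hC.of_injective (QuotientGroup.kerLift f) (QuotientGroup.kerLift_injective f) hY

theorem of_surjective (hC : IsRootClass C) (hquot : QuotClosed C) {X Y : Type u} [Group X]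
    [Group Y] (f : X →* Y) (hf : Function.Surjective f) (hX : C X) : C Y :=
  hC.1 _ _ (QuotientGroup.quotientKerEquivOfSurjective f hf) (hquot X f.ker hX)

/-- If `f` maps into a `C`-group and `ker f ≤ ker g`, then the image of `g` is a `C`-group. -/
theorem range_of_ker_le (hC : IsRootClass C) (hquot : QuotClosed C) {X Y Z : Type u} [Group X]
    [Group Y] [Group Z] (f : X →* Y) (hY : C Y) (g : X →* Z) (h : ∀ x, f x = 1 → g x = 1) :
    C g.range := by
  refine hC.of_surjective hquot (QuotientGroup.lift f.ker g.rangeRestrict ?_) ?_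
    (hC.quotient_ker f hY)
  · intro x hx
    ext
    exact h x hx
  · exact QuotientGroup.lift_surjective_of_surjective _ _ g.rangeRestrict_surjective _

/-- Gruenberg's condition in terms of homomorphisms. -/
theorem exists_hom_refining (hC : IsRootClass C) {X Y Z : Type u} [Group X] [Group Y] [Group Z]
    (f : X →* Y) (hY : C Y) (g : f.ker →* Z) (hZ : C Z) :
    ∃ (D : Type u) (_ : Group D) (p : X →* D), C D ∧
      ∀ x, p x = 1 → ∃ hx : x ∈ f.ker, g ⟨x, hx⟩ = 1 := by
  have hk : (g.ker.map f.ker.subtype).subgroupOf f.ker = g.ker :=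
    Subgroup.comap_map_eq_self_of_injective f.ker.subtype_injective _
  have hn : ((g.ker.map f.ker.subtype).subgroupOf f.ker).Normal := by
    rw [hk]
    infer_instance
  obtain ⟨T, hT, hTZ, hCT⟩ := hC.2.2.2 X f.ker (g.ker.map f.ker.subtype)
    (Subgroup.map_subtype_le _) inferInstance hn (hC.quotient_ker f hY)
    (hC.1 _ _ (QuotientGroup.quotientMulEquivOfEq hk.symm) (hC.quotient_ker g hZ))
  refine ⟨X ⧸ T, inferInstance, QuotientGroup.mk' T, hCT, fun x hx => ?_⟩
  obtain ⟨y, hy, rfl⟩ := hTZ ((QuotientGroup.eq_one_iff x).1 hx)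
  exact ⟨y.2, hy⟩

theorem of_extension (hC : IsRootClass C) {X Y Z : Type u} [Group X] [Group Y] [Group Z]
    (f : X →* Y) (hY : C Y) (g : f.ker →* Z) (hZ : C Z) (hg : Function.Injective g) : C X := by
  obtain ⟨D, _, p, hD, hp⟩ := hC.exists_hom_refining f hY g hZ
  refine hC.of_injective p ((injective_iff_map_eq_one p).2 fun x hx => ?_) hD
  obtain ⟨h1, h2⟩ := hp x hx
  simpa using (injective_iff_map_eq_one g).1 hg _ h2

theorem prod (hC : IsRootClass C) {X Y : Type u} [Group X] [Group Y] (hX : C X) (hY : C Y) :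
    C (X × Y) := by
  refine hC.of_extension (MonoidHom.fst X Y) hX
    ((MonoidHom.snd X Y).comp (MonoidHom.fst X Y).ker.subtype) hY
    ((injective_iff_map_eq_one _).2 ?_)
  rintro ⟨⟨x, y⟩, hx⟩ h
  simp only [MonoidHom.mem_ker, MonoidHom.coe_fst] at hx
  simp only [MonoidHom.comp_apply, Subgroup.coe_subtype, MonoidHom.coe_snd] at h
  subst hx h
  rfl

theorem semidirectProduct (hC : IsRootClass C) {N G : Type u} [Group N] [Group G]
    (θ : G →* MulAut N) (hN : C N) (hG : C G) : C (N ⋊[θ] G) := by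
  have hr : ∀ x : (SemidirectProduct.rightHom : N ⋊[θ] G →* G).ker, x.1.right = 1 := fun x => x.2
  refine hC.of_extension SemidirectProduct.rightHom hG
    { toFun := fun x => x.1.left
      map_one' := rfl
      map_mul' := fun x y => by simp [hr] } hN ?_
  intro x y hxy
  ext
  · exact hxy
  · rw [hr, hr]

theorem regularWreathProduct (hC : IsRootClass C) {D Q : Type u} [Group D] [Group Q]
    (hD : C D) (hQ : C Q) : C (D ≀ᵣ Q) := by
  have hr : ∀ x : (RegularWreathProduct.rightHom : D ≀ᵣ Q →* Q).ker, x.1.right = 1 := fun x => x.2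
  obtain ⟨E, _, p, hE, hp⟩ := hC.exists_hom_refining
    (RegularWreathProduct.rightHom : D ≀ᵣ Q →* Q) hQ
    { toFun := fun x => x.1.left 1
      map_one' := rfl
      map_mul' := fun x y => by simp [hr] } hD
  refine hC.of_injective p ((injective_iff_map_eq_one p).2 fun x hx => ?_) hE
  have key : ∀ q, ∃ h : x.right = 1, x.left q = 1 := by
    intro q
    have h1 : p ((RegularWreathProduct.inl q)⁻¹ * x * RegularWreathProduct.inl q) = 1 := by
      simp [hx]
    obtain ⟨h2, h3⟩ := hp _ h1
    have h4 : x.right = 1 := by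
      obtain ⟨h5, -⟩ := hp x hx
      exact h5
    refine ⟨h4, ?_⟩
    simpa using h3
  ext q
  · exact (key q).2
  · exact (key 1).1

/-- The join of two normal `C`-subgroups is a `C`-group. -/
theorem sup (hC : IsRootClass C) (hquot : QuotClosed C) {X : Type u} [Group X]
    (M N : Subgroup X) [M.Normal] (hM : C M) (hN : C N) : C ↥(M ⊔ N) := by
  have hle : ((QuotientGroup.mk' M).comp (M ⊔ N).subtype).range ≤
      ((QuotientGroup.mk' M).comp N.subtype).range := by
    rintro _ ⟨⟨x, hx⟩, rfl⟩
    obtain ⟨m, hm, n, hn, rfl⟩ := Subgroup.mem_sup_of_normal_left.1 hx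
    refine ⟨⟨n, hn⟩, ?_⟩
    simp [(QuotientGroup.eq_one_iff m).2 hm]
  have h1 : C ((QuotientGroup.mk' M).comp (M ⊔ N).subtype).range :=
    hC.of_injective (Subgroup.inclusion hle) (Subgroup.inclusion_injective hle)
      (hC.of_surjective hquot _ (MonoidHom.rangeRestrict_surjective _) hN)
  have hmem : ∀ x : ((QuotientGroup.mk' M).comp (M ⊔ N).subtype).rangeRestrict.ker,
      (x.1 : X) ∈ M := by
    intro x
    exact (QuotientGroup.eq_one_iff _).1 (congrArg Subtype.val (MonoidHom.mem_ker.1 x.2))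
  refine hC.of_extension _ h1
    (((M ⊔ N).subtype.comp (Subgroup.subtype _)).codRestrict M hmem) hM ?_
  intro x y hxy
  have h := Subtype.ext_iff.1 hxy
  exact Subtype.ext (Subtype.ext h)

theorem exists_ne_one (hC : IsRootClass C) : ∃ (Z : Type u) (_ : Group Z) (z : Z), C Z ∧ z ≠ 1 := by
  obtain ⟨Z, hZ, hCZ, hn⟩ := hC.2.1
  obtain ⟨z, hz⟩ := exists_ne (1 : Z)
  exact ⟨Z, hZ, z, hCZ, hz⟩

theorem of_subsingleton (hC : IsRootClass C) {X : Type u} [Group X] [Subsingleton X] : C X := by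
  obtain ⟨Z, _, _, hCZ, -⟩ := hC.exists_ne_one
  exact hC.of_injective (1 : X →* Z) (Function.injective_of_subsingleton _) hCZ

end IsRootClass

theorem exists_coset_representative {B Δ : Type*} [Group B] [Group Δ] (ρ : B →* Δ) :
    ∃ r : Δ → Δ, (∀ δ, ∃ b, ρ b * r δ = δ) ∧ ∀ b δ, r (ρ b * δ) = r δ := by
  refine ⟨fun δ => Quotient.out (Quotient.mk (QuotientGroup.rightRel ρ.range) δ),
    fun δ => ?_, fun b δ => ?_⟩
  · obtain ⟨b, hb⟩ := QuotientGroup.rightRel_apply.1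
      (Quotient.exact (Quotient.out_eq (Quotient.mk (QuotientGroup.rightRel ρ.range) δ)))
    exact ⟨b, by rw [hb]; group⟩
  · refine congrArg Quotient.out (Quotient.sound (QuotientGroup.rightRel_apply.2 ⟨b⁻¹, ?_⟩))
    simp

namespace RegularWreathProduct

/-- Two homomorphisms into a regular wreath product are conjugate as soon as they are so on the
components over the representatives of the orbits. -/
theorem exists_conj {H Γ Δ : Type*} [Group H] [Group Γ] [Group Δ] (f₁ f₂ : H →* Γ ≀ᵣ Δ) (τ : Δ)
    (hτ : ∀ h, (f₁ h).right * τ = τ * (f₂ h).right)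
    (hγ : ∀ r, ∃ γ : Γ, ∀ h, (f₁ h).right = 1 →
      (f₁ h).left r * γ = γ * (f₂ h).left (τ⁻¹ * r)) :
    ∃ w : Γ ≀ᵣ Δ, w.right = τ ∧ ∀ h, f₁ h * w = w * f₂ h := by
  choose γ hγ using hγ
  obtain ⟨r, hr, hr'⟩ := exists_coset_representative (RegularWreathProduct.rightHom.comp f₁)
  simp only [MonoidHom.comp_apply, rightHom_eq_right] at hr hr'
  choose s hs using hr
  have hinv : ∀ h x, (f₂ h).right⁻¹ * (τ⁻¹ * ((f₁ h).right * x)) = τ⁻¹ * x := fun h x => by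
    rw [eq_mul_inv_of_mul_eq (hτ h)]
    group
  have indep : ∀ h h' q, (f₁ h).right * r q = (f₁ h').right * r q →
      (f₁ h).left ((f₁ h).right * r q) * γ (r q) *
        ((f₂ h).left (τ⁻¹ * ((f₁ h).right * r q)))⁻¹ =
      (f₁ h').left ((f₁ h).right * r q) * γ (r q) *
        ((f₂ h').left (τ⁻¹ * ((f₁ h).right * r q)))⁻¹ := by
    intro h h' q e
    obtain ⟨k, rfl⟩ : ∃ k, h' = h * k := ⟨h⁻¹ * h', by simp⟩
    have hk : (f₁ k).right = 1 := by
      simpa [mul_assoc] using e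
    simp only [map_mul, mul_left, Pi.mul_apply, hinv, inv_mul_cancel_left, mul_inv_rev]
    rw [mul_assoc _ _ (γ (r q)), hγ (r q) k hk]
    group
  refine ⟨⟨fun q => (f₁ (s q)).left q * γ (r q) * ((f₂ (s q)).left (τ⁻¹ * q))⁻¹, τ⟩, rfl,
    fun h => ?_⟩
  ext q
  · simp only [mul_left]
    obtain ⟨p, rfl⟩ : ∃ p, q = (f₁ h).right * p := ⟨(f₁ h).right⁻¹ * q, by simp⟩
    have key := indep (h * s p) (s ((f₁ h).right * p)) p (by
      have h1 := hs ((f₁ h).right * p)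
      rw [hr'] at h1
      rw [h1, map_mul, mul_right, mul_assoc, hs])
    have h3 : (f₁ (h * s p)).right * r p = (f₁ h).right * p := by
      rw [map_mul, mul_right, mul_assoc, hs]
    rw [h3] at key
    simp only [Pi.mul_apply, hr', ← key, map_mul, mul_left, inv_mul_cancel_left, hinv]
    group
  · exact hτ h

end RegularWreathProduct

/-- The homomorphism into a regular wreath product that is induced by a family of homomorphisms
`η δ` of the kernel of `ρ`, constant on the right cosets of the image of `ρ`. -/
theorem exists_induced_hom {B Γ Δ : Type*} [Group B] [Group Γ] [Group Δ] (ρ : B →* Δ)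
    (η : Δ → B → Γ) (hη : ∀ δ x y, ρ x = 1 → ρ y = 1 → η δ (x * y) = η δ x * η δ y)
    (hinv : ∀ b δ, η (ρ b * δ) = η δ) :
    ∃ (f : B →* Γ ≀ᵣ Δ) (s : Δ → B), (∀ b, (f b).right = ρ b) ∧
      ∀ b, ρ b = 1 → ∀ q, (f b).left q = η q ((s q)⁻¹ * b * s q) := by
  obtain ⟨r, hr, hr'⟩ := exists_coset_representative ρ
  choose s hs using hr
  have hs' : ∀ b q, ρ ((s q)⁻¹ * b * s ((ρ b)⁻¹ * q)) = 1 := by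
    intro b q
    have h1 := eq_mul_inv_of_mul_eq (hs ((ρ b)⁻¹ * q))
    rw [← map_inv, hr'] at h1
    rw [map_mul, map_mul, map_inv, eq_mul_inv_of_mul_eq (hs q), ← map_inv, h1, map_inv]
    group
  refine ⟨MonoidHom.mk' (fun b => ⟨fun q => η q ((s q)⁻¹ * b * s ((ρ b)⁻¹ * q)), ρ b⟩) ?_, s,
    fun b => rfl, ?_⟩
  · intro b b'
    ext q
    · have h1 := hinv b⁻¹ q
      rw [map_inv] at h1
      simp only [RegularWreathProduct.mul_left, Pi.mul_apply, h1]
      rw [← hη _ _ _ (hs' b q) (hs' b' _)]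
      congr 1
      simp only [map_mul, mul_inv_rev, mul_assoc, mul_inv_cancel_left]
    · exact map_mul _ _ _
  · intro b hb q
    simp [hb]

theorem exists_compatible_induced_hom {B Γ Δ : Type*} [Group B] [Group Γ] [Group Δ]
    {H K : Subgroup B} (φ : H ≃* K) (ρ : B →* Δ) (τ : Δ) (hτ : ∀ h : H, τ * ρ h = ρ (φ h) * τ)
    (η : Δ → B → Γ) (hη : ∀ δ x y, ρ x = 1 → ρ y = 1 → η δ (x * y) = η δ x * η δ y)
    (hinv : ∀ b δ, η (ρ b * δ) = η δ)
    (hγ : ∀ δ x y, ∃ γ : Γ, ∀ h : H, ρ h = 1 → ρ (φ h) = 1 →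
      η (τ * δ) (y⁻¹ * φ h * y) * γ = γ * η δ (x⁻¹ * h * x)) :
    ∃ (f : B →* Γ ≀ᵣ Δ) (w : Γ ≀ᵣ Δ) (s : Δ → B), (∀ h : H, w * f h = f (φ h) * w) ∧
      (∀ b, (f b).right = ρ b) ∧
      ∀ b, ρ b = 1 → ∀ q, (f b).left q = η q ((s q)⁻¹ * b * s q) := by
  obtain ⟨f, s, hf, hfs⟩ := exists_induced_hom ρ η hη hinv
  obtain ⟨w, -, hw⟩ := RegularWreathProduct.exists_conj
    ((f.comp K.subtype).comp φ.toMonoidHom) (f.comp H.subtype) τ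
    (fun h => by
      change (f (φ h)).right * τ = τ * (f h).right
      rw [hf, hf, hτ])
    (fun r => by
      obtain ⟨γ, hγ⟩ := hγ (τ⁻¹ * r) (s (τ⁻¹ * r)) (s r)
      refine ⟨γ, fun h hh => ?_⟩
      change (f (φ h)).right = 1 at hh
      change (f (φ h)).left r * γ = γ * (f h).left (τ⁻¹ * r)
      rw [hf] at hh
      have hh' : ρ h = 1 := by
        have := hτ h
        rwa [hh, one_mul, mul_eq_left] at this
      have := hγ h hh' hh
      rwa [mul_inv_cancel_left, ← hfs _ hh, ← hfs _ hh'] at this)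
  exact ⟨f, w, s, fun h => (hw h).symm, hf, hfs⟩

/-- A homomorphism of `S` that is trivial on `S ⊓ N` extends to `S ⊔ N`. -/
theorem exists_extension_of_trivial_on_inf {B Γ : Type*} [Group B] [Group Γ] (S N : Subgroup B)
    [N.Normal] (g : S →* Γ) (hg : ∀ k : S, (k : B) ∈ N → g k = 1) :
    ∃ η : B → Γ, (∀ (k : S) (x : B), (k : B)⁻¹ * x ∈ N → η x = g k) ∧
      ∀ x ∈ S ⊔ N, ∀ y ∈ S ⊔ N, η (x * y) = η x * η y := by
  classical
  have hex : ∀ x ∈ S ⊔ N, ∃ k : S, (k : B)⁻¹ * x ∈ N := by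
    intro x hx
    obtain ⟨k, hk, n, hn, rfl⟩ := Subgroup.mem_sup_of_normal_right.1 hx
    exact ⟨⟨k, hk⟩, by simpa using hn⟩
  have huniq : ∀ (k k' : S) (x : B), (k : B)⁻¹ * x ∈ N → (k' : B)⁻¹ * x ∈ N → g k = g k' := by
    intro k k' x h h'
    have := hg (k⁻¹ * k') (by
      have h2 := N.mul_mem h (N.inv_mem h')
      rw [Subgroup.coe_mul, Subgroup.coe_inv]
      convert h2 using 1
      group)
    rwa [map_mul, map_inv, inv_mul_eq_one] at this
  have hη : ∀ (k : S) (x : B), (k : B)⁻¹ * x ∈ N →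
      (if h : ∃ k : S, (k : B)⁻¹ * x ∈ N then g h.choose else 1) = g k := by
    intro k x hk
    have h : ∃ k : S, (k : B)⁻¹ * x ∈ N := ⟨k, hk⟩
    rw [dif_pos h]
    exact huniq _ _ x h.choose_spec hk
  refine ⟨_, hη, fun x hx y hy => ?_⟩
  obtain ⟨k, hk⟩ := hex x hx
  obtain ⟨k', hk'⟩ := hex y hy
  have hkk : ((k * k' : S) : B)⁻¹ * (x * y) ∈ N := by
    have := N.mul_mem (‹N.Normal›.conj_mem _ hk (k' : B)⁻¹) hk'
    rw [Subgroup.coe_mul]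
    convert this using 1
    group
  rw [hη k x hk, hη k' y hk', hη _ _ hkk, map_mul]

theorem IsRootClass.quotient_of_le {C : GroupClass.{u}} (hC : IsRootClass C) (hquot : QuotClosed C)
    {B : Type u} [Group B] {R M : Subgroup B} [R.Normal] [M.Normal] (hle : R ≤ M)
    (hR : C (B ⧸ R)) : C (B ⧸ M) :=
  hC.of_surjective hquot (QuotientGroup.map R M (MonoidHom.id B) hle)
    (QuotientGroup.map_surjective_of_surjective _ _ _ QuotientGroup.mk_surjective _) hR

/-- Under the hypothesis that conjugation by elements of `B` on `K` corresponds to such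
conjugation on `H`, a normal subgroup `R` of finite `C`-index that is compatible with `φ` and
separates `H` and `K` is the kernel of a homomorphism of `B` that extends to the HNN-extension. -/
theorem IsRootClass.exists_compatible_hom {C : GroupClass.{u}} (hC : IsRootClass C)
    (hquot : QuotClosed C) {B : Type u} [Group B] {H K : Subgroup B} [H.Normal] [K.Normal]
    (φ : H ≃* K)
    (hcond : ∀ b : B, ∃ c : B, ∀ h h' : H, (h' : B) = c * h * c⁻¹ → (φ h' : B) = b * φ h * b⁻¹)
    (R : Subgroup B) [R.Normal] (hR : C (B ⧸ R)) (hRφ : ∀ h : H, (h : B) ∈ R ↔ (φ h : B) ∈ R)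
    (hRL : ∀ h ∈ H, ∀ k ∈ K, h⁻¹ * k ∈ R → h ∈ R) :
    ∃ (X : Type u) (_ : Group X) (f : B →* X) (τ : X), C X ∧
      (∀ h : H, τ * f h = f (φ h) * τ) ∧ ∀ b, f b = 1 ↔ b ∈ R := by
  classical
  obtain ⟨Z, _, z, hCZ, hz⟩ := hC.exists_ne_one
  have hRL' : ∀ h ∈ H, ∀ k ∈ K, h⁻¹ * k ∈ R → k ∈ R := fun h hh k hk hhk => by
    simpa using R.mul_mem (hRL h hh k hk hhk) hhk
  obtain ⟨η₁, hη₁, hη₁m⟩ := exists_extension_of_trivial_on_inf H (K ⊔ R)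
    ((QuotientGroup.mk' R).comp H.subtype) (by
      intro h hh
      obtain ⟨k, hk, r, hr, e⟩ := Subgroup.mem_sup_of_normal_left.1 hh
      refine (QuotientGroup.eq_one_iff _).2 (hRL h h.2 k hk ?_)
      rw [← e]
      simpa using hr)
  obtain ⟨η₂, hη₂, hη₂m⟩ := exists_extension_of_trivial_on_inf K (H ⊔ R)
    (((QuotientGroup.mk' R).comp H.subtype).comp φ.symm.toMonoidHom) (by
      intro k hk
      obtain ⟨h, hh, r, hr, e⟩ := Subgroup.mem_sup_of_normal_left.1 hk
      refine (QuotientGroup.eq_one_iff _).2 ((hRφ _).2 ?_)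
      change (φ (φ.symm k) : B) ∈ R
      rw [MulEquiv.apply_symm_apply]
      refine hRL' h hh k k.2 ?_
      rw [← e]
      simpa using hr)
  have e₁ : H ⊔ (K ⊔ R) = H ⊔ K ⊔ R := by rw [sup_assoc]
  have e₂ : K ⊔ (H ⊔ R) = H ⊔ K ⊔ R := by rw [← sup_assoc, sup_comm K]
  rw [e₁] at hη₁m
  rw [e₂] at hη₂m
  have one₁ : ∀ x ∈ K ⊔ R, η₁ x = 1 := fun x hx => by
    rw [hη₁ 1 x (by simpa using hx), map_one]
  have one₂ : ∀ x ∈ H ⊔ R, η₂ x = 1 := fun x hx => by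
    rw [hη₂ 1 x (by simpa using hx), map_one]
  set M : Subgroup B := H ⊔ K ⊔ R with hM
  set ρ : B →* (B ⧸ M) × Z := (QuotientGroup.mk' M).prod 1 with hρ
  have hker : ∀ b, ρ b = 1 ↔ b ∈ M := fun b => by
    simp [hρ, Prod.ext_iff]
  have hHM : H ≤ M := le_sup_left.trans le_sup_left
  have hKM : K ≤ M := le_sup_right.trans le_sup_left
  have hRM : R ≤ M := le_sup_right
  set η : (B ⧸ M) × Z → B → B ⧸ R :=
    fun d => if d.2 = 1 then η₁ else if d.2 = z then η₂ else 1 with hη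
  have hη_one : ∀ d, d.2 = 1 → η d = η₁ := fun d hd => if_pos hd
  have hη_z : ∀ d, d.2 = z → η d = η₂ := fun d hd => by
    rw [hη]
    simp only [hd, if_neg hz, if_true]
  have hηK : ∀ d, d.2 ≠ z → ∀ x ∈ K ⊔ R, η d x = 1 := fun d hd x hx => by
    simp only [hη, if_neg hd]
    split_ifs
    · exact one₁ x hx
    · rfl
  have hηH : ∀ d, d.2 ≠ 1 → ∀ x ∈ H ⊔ R, η d x = 1 := fun d hd x hx => by
    simp only [hη, if_neg hd]
    split_ifs
    · exact one₂ x hx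
    · rfl
  have hH : H.Normal := inferInstance
  have hK : K.Normal := inferInstance
  have hRn : R.Normal := inferInstance
  obtain ⟨f, w, s, hw, hf, hfs⟩ := exists_compatible_induced_hom φ ρ (1, z)
    (fun h => by
      rw [(hker _).2 (hHM h.2), (hker _).2 (hKM (φ h).2), one_mul, mul_one]) η
    (fun d x y hx hy => by
      rw [hker] at hx hy
      rw [hη]
      dsimp only
      split_ifs
      · exact hη₁m x hx y hy
      · exact hη₂m x hx y hy
      · simp)
    (fun b d => by simp [hη, hρ])
    (fun d x y => by
      by_cases hd : d.2 = 1
      · obtain ⟨c, hc⟩ := hcond y⁻¹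
        refine ⟨QuotientGroup.mk' R (c * x), fun h _ _ => ?_⟩
        rw [hη_one d hd, hη_z _ (by simp [hd])]
        have h1 := hc h ⟨c * h * c⁻¹, hH.conj_mem _ h.2 c⟩ rfl
        rw [inv_inv] at h1
        rw [hη₂ (φ ⟨c * h * c⁻¹, hH.conj_mem _ h.2 c⟩) _ (by simp only [h1, inv_mul_cancel, one_mem]),
          hη₁ ⟨x⁻¹ * h * x, by simpa using hH.conj_mem _ h.2 x⁻¹⟩ _ (by simp only [inv_mul_cancel, one_mem])]
        change QuotientGroup.mk' R ((φ.symm (φ _) : H) : B) * _ = _ * QuotientGroup.mk' R _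
        rw [MulEquiv.symm_apply_apply, ← map_mul, ← map_mul]
        refine congrArg (QuotientGroup.mk' R) ?_
        change c * h * c⁻¹ * (c * x) = c * x * (x⁻¹ * h * x)
        group
      · refine ⟨1, fun h _ _ => ?_⟩
        rw [hηK _ (by simpa using hd) _ (le_sup_left (a := K) (b := R)
            (by simpa using hK.conj_mem _ (φ h).2 y⁻¹)),
          hηH _ hd _ (le_sup_left (a := H) (b := R) (by simpa using hH.conj_mem _ h.2 x⁻¹))])
  have hCΔ : C ((B ⧸ M) × Z) := hC.prod (hC.quotient_of_le hquot hRM hR) hCZ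
  refine ⟨_, _, f, w, hC.regularWreathProduct hR hCΔ, hw, fun b => ⟨fun hb => ?_, fun hb => ?_⟩⟩
  · have hb1 : ρ b = 1 := by rw [← hf, hb, RegularWreathProduct.one_right]
    have hbM := (hker b).1 hb1
    have hleft : ∀ q, η q ((s q)⁻¹ * b * s q) = 1 := fun q => by
      rw [← hfs b hb1, hb]
      rfl
    have hbK : b ∈ K ⊔ R := by
      have h1 := hleft 1
      rw [hη_one _ rfl] at h1
      set t := s 1
      have hx : t⁻¹ * b * t ∈ H ⊔ (K ⊔ R) := by
        rw [e₁]
        simpa using (inferInstance : M.Normal).conj_mem _ hbM t⁻¹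
      obtain ⟨k, hk, n, hn, e⟩ := Subgroup.mem_sup_of_normal_left.1 hx
      rw [hη₁ ⟨k, hk⟩ _ (by rw [← e]; simpa using hn)] at h1
      have h2 : k ∈ R := (QuotientGroup.eq_one_iff _).1 h1
      have h3 : t⁻¹ * b * t ∈ K ⊔ R := e ▸ mul_mem (le_sup_right (a := K) (b := R) h2) hn
      have := (inferInstance : (K ⊔ R).Normal).conj_mem _ h3 t
      convert this using 1
      group
    have hbH : b ∈ H ⊔ R := by
      have h1 := hleft (1, z)
      rw [hη_z _ rfl] at h1
      set t := s (1, z)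
      have hx : t⁻¹ * b * t ∈ K ⊔ (H ⊔ R) := by
        rw [e₂]
        simpa using (inferInstance : M.Normal).conj_mem _ hbM t⁻¹
      obtain ⟨k, hk, n, hn, e⟩ := Subgroup.mem_sup_of_normal_left.1 hx
      rw [hη₂ ⟨k, hk⟩ _ (by rw [← e]; simpa using hn)] at h1
      have h2 : (φ.symm ⟨k, hk⟩ : B) ∈ R := (QuotientGroup.eq_one_iff _).1 h1
      rw [hRφ, MulEquiv.apply_symm_apply] at h2
      have h3 : t⁻¹ * b * t ∈ H ⊔ R := e ▸ mul_mem (le_sup_right (a := H) (b := R) h2) hn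
      have := (inferInstance : (H ⊔ R).Normal).conj_mem _ h3 t
      convert this using 1
      group
    obtain ⟨k, hk, r, hr, rfl⟩ := Subgroup.mem_sup_of_normal_left.1 hbK
    obtain ⟨h, hh, r', hr', e⟩ := Subgroup.mem_sup_of_normal_left.1 hbH
    refine mul_mem (hRL' h hh k hk ?_) hr
    have : h⁻¹ * k = r' * r⁻¹ := by
      rw [inv_mul_eq_iff_eq_mul, ← mul_assoc, e, mul_inv_cancel_right]
    rw [this]
    exact mul_mem hr' (inv_mem hr)
  · have hb1 : ρ b = 1 := (hker b).2 (hRM hb)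
    refine RegularWreathProduct.ext (funext fun q => ?_) ?_
    · rw [hfs b hb1]
      have hx : (s q)⁻¹ * b * s q ∈ R := by simpa using hRn.conj_mem _ hb (s q)⁻¹
      by_cases hq : q.2 = z
      · exact hηH _ (hq ▸ hz) _ (le_sup_right (a := H) (b := R) hx)
      · exact hηK _ hq _ (le_sup_right (a := K) (b := R) hx)
    · rw [hf, hb1]
      rfl

/-- A homomorphism of `L ⋊ V` that is trivial on `L ⊓ Q` gives rise to a homomorphism of `B`
that extends to the HNN-extension. -/
theorem exists_compatible_hom_of_semidirectProduct {B Γ Δ : Type*} [Group B] [Group Γ] [Group Δ]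
    {H K L : Subgroup B} [L.Normal] (φ : H ≃* K) (hL : ∀ x, x ∈ L ↔ x ∈ H ∧ x ∈ K)
    (V : Subgroup (MulAut L)) (hV : ∀ b : B, MulAut.conjNormal b ∈ V) (ψ : MulAut L) (hψV : ψ ∈ V)
    (hψ : ∀ (l : L) (h : H), (h : B) = l → (ψ l : B) = φ h)
    (κ : L ⋊[V.subtype] V →* Γ) (Q : Subgroup B) [Q.Normal]
    (hQφ : ∀ h : H, (h : B) ∈ Q → (φ h : B) ∈ Q)
    (hQκ : ∀ l : L, (l : B) ∈ Q → κ (SemidirectProduct.inl l) = 1)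
    (ρ : B →* Δ) (τ : Δ) (hτ : ∀ h : H, τ * ρ h = ρ (φ h) * τ) (hρ : ∀ b, ρ b = 1 ↔ b ∈ L ⊔ Q) :
    ∃ (f : B →* Γ ≀ᵣ Δ) (w : Γ ≀ᵣ Δ), (∀ h : H, w * f h = f (φ h) * w) ∧
      ∀ l : L, κ (SemidirectProduct.inl l) ≠ 1 → f l ≠ 1 := by
  obtain ⟨η, hη, hηm⟩ := exists_extension_of_trivial_on_inf L Q (κ.comp SemidirectProduct.inl)
    hQκ
  have hκ : ∀ (α : V) (l : L), κ (SemidirectProduct.inl ((α : MulAut L) l)) =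
      κ (SemidirectProduct.inr α) * κ (SemidirectProduct.inl l) *
        (κ (SemidirectProduct.inr α))⁻¹ := fun α l => by
    have := SemidirectProduct.inl_aut (φ := V.subtype) α l
    rw [Subgroup.coe_subtype] at this
    rw [this, map_mul, map_mul, map_inv, map_inv]
  have hQ : Q.Normal := inferInstance
  have hηc : ∀ (l : L) (x y : B), (l : B)⁻¹ * x ∈ Q →
      η (y⁻¹ * x * y) = κ (SemidirectProduct.inl (MulAut.conjNormal y⁻¹ l)) := fun l x y h => by
    refine hη _ _ ?_
    rw [MulAut.conjNormal_apply]
    convert hQ.conj_mem _ h y⁻¹ using 1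
    group
  obtain ⟨f, w, s, hw, -, hfs⟩ := exists_compatible_induced_hom φ ρ τ hτ (fun _ => η)
    (fun _ x y hx hy => hηm x ((hρ x).1 hx) y ((hρ y).1 hy)) (fun _ _ => rfl)
    (fun _ x y => by
      refine ⟨κ (SemidirectProduct.inr
        ((⟨_, hV y⁻¹⟩ : V) * ⟨ψ, hψV⟩ * (⟨_, hV x⁻¹⟩ : V)⁻¹)), fun h hh _ => ?_⟩
      obtain ⟨l, hl, q, hq, e⟩ := Subgroup.mem_sup_of_normal_right.1 ((hρ _).1 hh)
      have hlH : l ∈ H := ((hL l).1 hl).1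
      have h1 : (l : B)⁻¹ * h ∈ Q := by
        rw [← e]
        simpa using hq
      have h2 : ((ψ ⟨l, hl⟩ : L) : B)⁻¹ * φ h ∈ Q := by
        rw [hψ ⟨l, hl⟩ ⟨l, hlH⟩ rfl, ← Subgroup.coe_inv, ← Subgroup.coe_mul, ← map_inv, ← map_mul]
        exact hQφ _ h1
      rw [hηc _ _ _ h2, hηc ⟨l, hl⟩ _ _ h1, hκ ⟨_, hV _⟩, hκ ⟨_, hψV⟩, hκ ⟨_, hV _⟩]
      simp only [map_mul, map_inv]
      group)
  refine ⟨f, w, hw, fun l hl h => hl ?_⟩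
  have h1 := hfs l ((hρ _).2 (le_sup_left (a := L) (b := Q) l.2)) 1
  rw [hηc l l _ (by simp only [inv_mul_cancel, one_mem]), h, hκ ⟨_, hV _⟩] at h1
  rw [eq_comm] at h1
  simpa using h1

theorem IsRootClass.quotient_inf {C : GroupClass.{u}} (hC : IsRootClass C) {B : Type u} [Group B]
    {M N : Subgroup B} [M.Normal] [N.Normal] (hM : C (B ⧸ M)) (hN : C (B ⧸ N)) :
    C (B ⧸ (M ⊓ N)) := by
  have h : ((QuotientGroup.mk' M).prod (QuotientGroup.mk' N)).ker = M ⊓ N := by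
    rw [MonoidHom.ker_prod, QuotientGroup.ker_mk', QuotientGroup.ker_mk']
  exact hC.1 _ _ (QuotientGroup.quotientMulEquivOfEq h) (hC.quotient_ker _ (hC.prod hM hN))

/-- The homomorphism form of quasi-regularity. -/
def HomQuasiRegular (C : GroupClass.{u}) (X : Type u) [Group X] (Y : Subgroup X) : Prop :=
  ∀ (D : Type u) [Group D] (f : Y →* D), C D →
    ∃ N : Subgroup X, ∃ _ : N.Normal, C (X ⧸ N) ∧ ∀ x : Y, (x : X) ∈ N → f x = 1

theorem IsRootClass.homQuasiRegular {C : GroupClass.{u}} (hC : IsRootClass C) {X : Type u} [Group X]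
    {Y : Subgroup X} (h : QuasiRegular C X Y) : HomQuasiRegular C X Y := by
  intro D _ f hD
  obtain ⟨N, ⟨hN, hCN⟩, hle⟩ := h f.ker ⟨inferInstance, hC.quotient_ker f hD⟩
  exact ⟨N, hN, hCN, fun x hx => hle (Subgroup.mem_subgroupOf.2 hx)⟩

/-- Quasi-regularity with respect to `H ⊔ K` yields a normal subgroup of finite `C`-index whose
trace on `H ⊔ K` is the given product. -/
theorem IsRootClass.exists_normal_inf_le {C : GroupClass.{u}} (hC : IsRootClass C)
    (hquot : QuotClosed C) {B : Type u} [Group B] {H K : Subgroup B} [H.Normal] [K.Normal]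
    (hqr : HomQuasiRegular C B (H ⊔ K)) (A A' : Subgroup B) [A.Normal] [A'.Normal]
    {D : Type u} [Group D] (hD : C D) (f : H →* D) (hf : ∀ h, f h = 1 → (h : B) ∈ A)
    (f' : K →* D) (hf' : ∀ k, f' k = 1 → (k : B) ∈ A') :
    ∃ N : Subgroup B, ∃ _ : N.Normal, C (B ⧸ N) ∧ ∀ x ∈ H ⊔ K, x ∈ N → x ∈ A ⊔ A' := by
  set π := QuotientGroup.mk' (A ⊔ A') with hπ
  have h1 : C (π.comp H.subtype).range := hC.range_of_ker_le hquot f hD _ fun h hh =>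
    (QuotientGroup.eq_one_iff _).2 (le_sup_left (a := A) (hf h hh))
  have h2 : C (π.comp K.subtype).range := hC.range_of_ker_le hquot f' hD _ fun h hh =>
    (QuotientGroup.eq_one_iff _).2 (le_sup_right (a := A) (hf' h hh))
  have e1 : (π.comp H.subtype).range = H.map π := by
    rw [MonoidHom.range_comp, Subgroup.range_subtype]
  have e2 : (π.comp K.subtype).range = K.map π := by
    rw [MonoidHom.range_comp, Subgroup.range_subtype]
  have : (H.map π).Normal :=
    Subgroup.Normal.map inferInstance π (QuotientGroup.mk'_surjective _)
  rw [e1] at h1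
  rw [e2] at h2
  obtain ⟨N, hN, hCN, hNf⟩ := hqr _
    ((π.comp (H ⊔ K).subtype).codRestrict (H.map π ⊔ K.map π) (fun x => by
      rw [← Subgroup.map_sup]
      exact Subgroup.mem_map_of_mem _ x.2)) (hC.sup hquot _ _ h1 h2)
  refine ⟨N, hN, hCN, fun x hx hxN => (QuotientGroup.eq_one_iff _).1 ?_⟩
  have h := Subtype.ext_iff.1 (hNf ⟨x, hx⟩ hxN)
  exact h

/-- The image under `φ` of a normal subgroup of `B` is normal. -/
theorem normal_map_of_cond {B : Type*} [Group B] {H K : Subgroup B} (φ : H ≃* K)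
    (hcond : ∀ b : B, ∃ c : B, ∀ h h' : H, (h' : B) = c * h * c⁻¹ → (φ h' : B) = b * φ h * b⁻¹)
    (A : Subgroup B) [A.Normal] (hAH : A ≤ H) :
    ((A.subgroupOf H).map (K.subtype.comp φ.toMonoidHom)).Normal := by
  refine ⟨?_⟩
  rintro _ ⟨a, ha, rfl⟩ b
  obtain ⟨c, hc⟩ := hcond b
  have h1 := (inferInstance : A.Normal).conj_mem _ ha c
  refine ⟨⟨c * a * c⁻¹, hAH h1⟩, h1, ?_⟩
  exact hc a _ rfl

theorem IsRootClass.exists_compatible_hom_of_le {C : GroupClass.{u}} (hC : IsRootClass C)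
    (hquot : QuotClosed C) {B : Type u} [Group B] {H K L : Subgroup B} [H.Normal] [K.Normal]
    [L.Normal] (φ : H ≃* K)
    (hcond : ∀ b : B, ∃ c : B, ∀ h h' : H, (h' : B) = c * h * c⁻¹ → (φ h' : B) = b * φ h * b⁻¹)
    (hL : ∀ x, x ∈ L ↔ x ∈ H ∧ x ∈ K) (hLφ : ∀ h : H, (h : B) ∈ K ↔ (φ h : B) ∈ H)
    (hqr : HomQuasiRegular C B (H ⊔ K)) (A : Subgroup B) [A.Normal] (hAH : A ≤ H)
    (hAφ : ∀ h : H, (h : B) ∈ K → ((h : B) ∈ A ↔ (φ h : B) ∈ A))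
    {D : Type u} [Group D] (hD : C D) (f : H →* D) (hf : ∀ h, f h = 1 → (h : B) ∈ A)
    (N₀ : Subgroup B) [N₀.Normal] (hN₀ : C (B ⧸ N₀)) (hAN₀ : A ≤ N₀)
    (hAN₀' : ∀ h : H, (h : B) ∈ A → (φ h : B) ∈ N₀) :
    ∃ Q : Subgroup B, ∃ _ : Q.Normal, Q ≤ N₀ ∧ (∀ h ∈ H, h ∈ Q → h ∈ A) ∧
      (∀ h : H, (h : B) ∈ Q → (φ h : B) ∈ Q) ∧
      ∃ (X : Type u) (_ : Group X) (f : B →* X) (τ : X), C X ∧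
        (∀ h : H, τ * f h = f (φ h) * τ) ∧ ∀ b, f b = 1 ↔ b ∈ L ⊔ Q := by
  obtain ⟨A', hA'⟩ : ∃ A' : Subgroup B,
      A' = (A.subgroupOf H).map (K.subtype.comp φ.toMonoidHom) := ⟨_, rfl⟩
  have hA'n : A'.Normal := hA' ▸ normal_map_of_cond φ hcond A hAH
  have hA'φ : ∀ h : H, (φ h : B) ∈ A' ↔ (h : B) ∈ A := fun h => by
    rw [hA']
    constructor
    · rintro ⟨a, ha, e⟩
      have : a = h := φ.injective (Subtype.ext e)
      exact this ▸ ha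
    · exact fun hh => ⟨h, hh, rfl⟩
  have hA'K : A' ≤ K := by
    rw [hA']
    rintro _ ⟨a, -, rfl⟩
    exact (φ a).2
  have hA'ex : ∀ k ∈ K, ∃ h : H, (φ h : B) = k := fun k hk =>
    ⟨φ.symm ⟨k, hk⟩, by rw [MulEquiv.apply_symm_apply]⟩
  obtain ⟨N, hN, hCN, hNA⟩ := hC.exists_normal_inf_le hquot hqr A A' hD f hf
    (f.comp φ.symm.toMonoidHom) (fun k hk => by
      rw [← φ.apply_symm_apply k]
      exact (hA'φ _).2 (hf _ hk))
  have hAA' : A ⊔ A' ≤ H ⊔ K := sup_le_sup hAH hA'K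
  have hA'A : ∀ k ∈ A', k ∈ H → k ∈ A := fun k hk hkH => by
    obtain ⟨h, rfl⟩ := hA'ex k (hA'K hk)
    exact (hAφ h ((hLφ h).2 hkH)).1 ((hA'φ h).1 hk)
  have hAA'' : ∀ h ∈ A, h ∈ K → h ∈ A' := fun x hx hxK => by
    obtain ⟨h, rfl⟩ := hA'ex x hxK
    exact (hA'φ h).2 ((hAφ h ((hLφ h).2 (hAH hx))).2 hx)
  have hdec : ∀ h ∈ H, ∀ k ∈ K, h⁻¹ * k ∈ A ⊔ A' → ∃ l ∈ L, ∃ a ∈ A, ∃ a' ∈ A',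
      h = l * a ∧ k = l * a' := fun h hh k hk hhk => by
    obtain ⟨a, ha, a', ha', e⟩ := Subgroup.mem_sup_of_normal_left.1 hhk
    rw [eq_inv_mul_iff_mul_eq] at e
    refine ⟨h * a, (hL _).2 ⟨mul_mem hh (hAH ha), ?_⟩, a⁻¹, inv_mem ha, a', ha', by group, ?_⟩
    · rw [eq_mul_inv_of_mul_eq ((mul_assoc _ _ _).trans e)]
      exact mul_mem hk (inv_mem (hA'K ha'))
    · rw [← e, mul_assoc]
  obtain ⟨Q, hQ⟩ : ∃ Q : Subgroup B, Q = (N ⊓ N₀) ⊔ (A ⊔ A') := ⟨_, rfl⟩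
  have hQn : Q.Normal := hQ ▸ inferInstance
  have hAQ : A ≤ Q := hQ ▸ le_sup_left.trans le_sup_right
  have hA'Q : A' ≤ Q := hQ ▸ le_sup_right.trans le_sup_right
  have hQA : ∀ x ∈ H ⊔ K, x ∈ Q → x ∈ A ⊔ A' := fun x hx hxQ => by
    rw [hQ] at hxQ
    obtain ⟨n, hn, a, ha, rfl⟩ := Subgroup.mem_sup_of_normal_left.1 hxQ
    exact mul_mem (hNA n ((mul_mem_cancel_right (hAA' ha)).1 hx) hn.1) ha
  have hHK : ∀ h ∈ H, ∀ k ∈ K, h⁻¹ * k ∈ H ⊔ K := fun h hh k hk =>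
    mul_mem (inv_mem (le_sup_left (a := H) (b := K) hh)) (le_sup_right (a := H) (b := K) hk)
  have hQH : ∀ h ∈ H, h ∈ Q → h ∈ A := fun h hh hhQ => by
    obtain ⟨a, ha, a', ha', rfl⟩ :=
      Subgroup.mem_sup_of_normal_left.1 (hQA h (le_sup_left (a := H) hh) hhQ)
    exact mul_mem ha (hA'A a' ha' ((mul_mem_cancel_left (hAH ha)).1 hh))
  have hQK : ∀ k ∈ K, k ∈ Q → k ∈ A' := fun k hk hkQ => by
    obtain ⟨a, ha, a', ha', rfl⟩ :=
      Subgroup.mem_sup_of_normal_left.1 (hQA k (le_sup_right (a := H) hk) hkQ)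
    exact mul_mem (hAA'' a ha ((mul_mem_cancel_right (hA'K ha')).1 hk)) ha'
  have hCQ : C (B ⧸ Q) :=
    hC.quotient_of_le hquot (hQ ▸ le_sup_left) (hC.quotient_inf hCN hN₀)
  refine ⟨Q, hQn, hQ ▸ sup_le inf_le_right (sup_le hAN₀ ?_), hQH,
    fun h hh => hA'Q ((hA'φ h).2 (hQH h h.2 hh)), ?_⟩
  · intro k hk
    obtain ⟨h, rfl⟩ := hA'ex k (hA'K hk)
    exact hAN₀' h ((hA'φ h).1 hk)
  · refine hC.exists_compatible_hom hquot φ hcond (L ⊔ Q)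
      (hC.quotient_of_le hquot le_sup_right hCQ) (fun h => ⟨fun hh => ?_, fun hh => ?_⟩) ?_
    · obtain ⟨l, hl, q, hq, e⟩ := Subgroup.mem_sup_of_normal_left.1 hh
      have hlH := ((hL l).1 hl).1
      have hqH : q ∈ H := (mul_mem_cancel_left hlH).1 (e ▸ h.2)
      have e' : h = ⟨l, hlH⟩ * ⟨q, hqH⟩ := Subtype.ext e.symm
      rw [e', map_mul, Subgroup.coe_mul]
      refine mul_mem (le_sup_left (a := L) ((hL _).2
        ⟨(hLφ ⟨l, hlH⟩).1 ((hL l).1 hl).2, (φ _).2⟩)) (le_sup_right (a := L) (hA'Q ?_))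
      exact (hA'φ _).2 (hQH q hqH hq)
    · obtain ⟨l, hl, q, hq, e⟩ := Subgroup.mem_sup_of_normal_left.1 hh
      have hlK := ((hL l).1 hl).2
      have hqK : q ∈ K := (mul_mem_cancel_left hlK).1 (e ▸ (φ h).2)
      obtain ⟨x, rfl⟩ := hA'ex l hlK
      obtain ⟨y, rfl⟩ := hA'ex q hqK
      have e' : h = x * y := φ.injective (Subtype.ext (by rw [map_mul, Subgroup.coe_mul, e]))
      rw [e', Subgroup.coe_mul]
      exact mul_mem (le_sup_left (a := L) ((hL _).2 ⟨x.2, (hLφ x).2 ((hL _).1 hl).1⟩))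
        (le_sup_right (a := L) (hAQ ((hA'φ y).1 (hQK _ hqK hq))))
    · intro h hh k hk hhk
      obtain ⟨l, hl, q, hq, e⟩ := Subgroup.mem_sup_of_normal_right.1 hhk
      have hlK := ((hL l).1 hl).2
      have hlH := ((hL l).1 hl).1
      have h1 : (h * l)⁻¹ * k ∈ Q := by
        rw [mul_inv_rev, mul_assoc, ← e]
        simpa using hq
      obtain ⟨l', hl', a, ha, a', ha', e1, -⟩ := hdec _ (mul_mem hh hlH) k hk
        (hQA _ (hHK _ (mul_mem hh hlH) k hk) h1)
      rw [eq_mul_inv_of_mul_eq e1]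
      exact mul_mem (mul_mem (le_sup_left (a := L) hl') (le_sup_right (a := L) (hAQ ha)))
        (inv_mem (le_sup_left (a := L) hl))

theorem IsRootClass.residually_of_hom {C : GroupClass.{u}} (hC : IsRootClass C) {X : Type u}
    [Group X] (h : ∀ x : X, x ≠ 1 → ∃ (G : Type u) (_ : Group G) (f : X →* G), C G ∧ f x ≠ 1) :
    Residually C X := fun x hx => by
  obtain ⟨G, _, f, hG, hfx⟩ := h x hx
  exact ⟨f.range, inferInstance, f.rangeRestrict, f.rangeRestrict_surjective,
    hC.2.2.1 G f.range hG, fun h => hfx (congrArg Subtype.val h)⟩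

namespace HNNExtension

variable {B : Type u} [Group B] {H K : Subgroup B} {φ : H ≃* K}

/-- The product of a list of syllables `t ^ u * g`. -/
def syllableProd (φ : H ≃* K) (l : List (ℤˣ × B)) : HNNExtension B H K φ :=
  (l.map fun x => t ^ (x.1 : ℤ) * of x.2).prod

@[simp]
theorem syllableProd_nil : syllableProd φ [] = 1 := rfl

@[simp]
theorem syllableProd_cons (u : ℤˣ) (g : B) (l : List (ℤˣ × B)) :
    syllableProd φ ((u, g) :: l) = t ^ (u : ℤ) * (of g * syllableProd φ l) := by
  simp [syllableProd, mul_assoc]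

theorem exists_reduced_eq (e : HNNExtension B H K φ) :
    ∃ (g : B) (l : List (ℤˣ × B)),
      l.IsChain (fun a b => a.2 ∈ toSubgroup H K a.1 → a.1 = b.1) ∧
        e = of g * syllableProd φ l := by
  obtain ⟨d⟩ := NormalWord.TransversalPair.nonempty B H K
  let w := NormalWord.equiv φ d e
  exact ⟨w.head, w.toList, w.chain, ((NormalWord.equiv φ d).symm_apply_apply e).symm⟩

/-- A homomorphism separates the syllables of a list from the associated subgroups. -/
def Separates {X : Type*} [Group X] (ρ : HNNExtension B H K φ →* X) (l : List (ℤˣ × B)) : Prop :=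
  ∀ p ∈ l, p.2 ∉ toSubgroup H K p.1 → ∀ s ∈ toSubgroup H K p.1, ρ (of s) ≠ ρ (of p.2)

theorem exists_separates {C : GroupClass.{u}} (hC : IsRootClass C)
    (hH : ∀ b ∉ H, ∃ (X : Type u) (_ : Group X) (f : HNNExtension B H K φ →* X), C X ∧
      ∀ s ∈ H, f (of s) ≠ f (of b))
    (hK : ∀ b ∉ K, ∃ (X : Type u) (_ : Group X) (f : HNNExtension B H K φ →* X), C X ∧
      ∀ s ∈ K, f (of s) ≠ f (of b)) (l : List (ℤˣ × B)) :
    ∃ (X : Type u) (_ : Group X) (ρ : HNNExtension B H K φ →* X), C X ∧ Separates ρ l := by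
  induction l with
  | nil => exact ⟨PUnit, inferInstance, 1, hC.of_subsingleton, by simp [Separates]⟩
  | cons p l ih =>
    obtain ⟨X, _, ρ, hX, hρ⟩ := ih
    obtain ⟨Y, _, f, hY, hf⟩ : ∃ (Y : Type u) (_ : Group Y) (f : HNNExtension B H K φ →* Y), C Y ∧
        (p.2 ∉ toSubgroup H K p.1 → ∀ s ∈ toSubgroup H K p.1, f (of s) ≠ f (of p.2)) := by
      by_cases hp : p.2 ∈ toSubgroup H K p.1
      · exact ⟨PUnit, inferInstance, 1, hC.of_subsingleton, fun h => absurd hp h⟩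
      · obtain ⟨u, g⟩ := p
        rcases Int.units_eq_one_or u with rfl | rfl
        · obtain ⟨Y, _, f, hY, hf⟩ := hH g hp
          exact ⟨Y, _, f, hY, fun _ => hf⟩
        · obtain ⟨Y, _, f, hY, hf⟩ := hK g hp
          exact ⟨Y, _, f, hY, fun _ => hf⟩
    refine ⟨X × Y, inferInstance, ρ.prod f, hC.prod hX hY, fun q hq hqu s hs h => ?_⟩
    rw [MonoidHom.prod_apply, MonoidHom.prod_apply, Prod.mk.injEq] at h
    rcases List.mem_cons.1 hq with rfl | hq
    · exact hf hqu s hs h.2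
    · exact hρ q hq hqu s hs h.1

/-- A homomorphism to `X` extends to a wreath product by twisting the image of `t` by a function
that is constant on the right cosets of the image of `K`. -/
theorem exists_twist {X Z : Type*} [Group X] [Group Z] (ρ : HNNExtension B H K φ →* X) (δ : X → Z)
    (hδ : ∀ (k : K) (x : X), δ (ρ (of k) * x) = δ x) :
    ∃ F : HNNExtension B H K φ →* Z ≀ᵣ X, (∀ e, (F e).right = ρ e) ∧
      (∀ b, (F (of b)).left = 1) ∧ (F t).left = δ := by
  have hinv : ∀ (k : K) (x : X), δ ((ρ (of k))⁻¹ * x) = δ x := fun k x => by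
    rw [← hδ k, mul_inv_cancel_left]
  let F : HNNExtension B H K φ →* Z ≀ᵣ X :=
    lift (RegularWreathProduct.inl.comp (ρ.comp of)) ⟨δ, ρ t⟩ (fun h => by
      refine RegularWreathProduct.ext (funext fun q => ?_) ?_
      · simp [hinv]
      · change ρ t * ρ (of h) = ρ (of (φ h)) * ρ t
        rw [← map_mul, t_mul_of, map_mul])
  have h1 : RegularWreathProduct.rightHom.comp F = ρ := by
    refine hom_ext ?_ ?_
    · ext b
      simp [F]
    · simp [F]
  refine ⟨F, fun e => DFunLike.congr_fun h1 e, fun b => ?_, ?_⟩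
  · simp [F]
  · simp [F]

theorem exists_separating_suffixes {C : GroupClass.{u}} (hC : IsRootClass C)
    (l : List (ℤˣ × B)) (hl : l.IsChain (fun a b => a.2 ∈ toSubgroup H K a.1 → a.1 = b.1))
    {X : Type u} [Group X] (hX : C X) (ρ : HNNExtension B H K φ →* X) (hρ : Separates ρ l) :
    ∃ (Y : Type u) (_ : Group Y) (σ : HNNExtension B H K φ →* Y), C Y ∧
      (∀ x y, σ x = σ y → ρ x = ρ y) ∧
      ∀ s₁ s₂, s₁ <:+ l → s₂ <:+ l → ∀ b,
        σ (syllableProd φ s₁) = σ (of b) * σ (syllableProd φ s₂) → s₁ = s₂ := by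
  classical
  induction l with
  | nil =>
    refine ⟨X, inferInstance, ρ, hX, fun _ _ h => h, fun s₁ s₂ h₁ h₂ _ _ => ?_⟩
    rw [List.suffix_nil.1 h₁, List.suffix_nil.1 h₂]
  | cons p l ih =>
    obtain ⟨u, g⟩ := p
    obtain ⟨Y, _, σ, hY, hσρ, hσ⟩ := ih hl.tail (fun p hp => hρ p (List.mem_cons_of_mem _ hp))
    have hsep := hρ (u, g) List.mem_cons_self
    obtain ⟨Z, _, z, hCZ, hz⟩ := hC.exists_ne_one
    set v : Y := σ ((if u = 1 then t else 1) * (of g * syllableProd φ l)) with hv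
    let δ : Y → Z := fun x => if ∃ k : K, x = σ (of k) * v then z else 1
    have hδ : ∀ (k : K) (x : Y), δ (σ (of k) * x) = δ x := fun k x => by
      refine if_congr ⟨?_, ?_⟩ rfl rfl
      · rintro ⟨k', hk'⟩
        refine ⟨k⁻¹ * k', ?_⟩
        rw [Subgroup.coe_mul, map_mul, map_mul, mul_assoc, ← hk', Subgroup.coe_inv, map_inv,
          map_inv, inv_mul_cancel_left]
      · rintro ⟨k', rfl⟩
        exact ⟨k * k', by rw [Subgroup.coe_mul, map_mul, map_mul, mul_assoc]⟩
    obtain ⟨F, hFr, hFb, hFt⟩ := exists_twist σ δ hδ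
    let W : HNNExtension B H K φ → Z := fun e => (F e).left (σ e)
    have hWb : ∀ b e, W (of b * e) = W e := fun b e => by
      simp [W, hFb, hFr]
    have hWt : ∀ e, W (t * e) = δ (σ (t * e)) * W e := fun e => by
      simp [W, hFt, hFr]
    have hWt' : ∀ e, W (t⁻¹ * e) = (δ (σ e))⁻¹ * W e := fun e => by
      simp [W, hFt, hFr]
    have hk : ∀ k : K, ∃ h : H, (of (k : B) : HNNExtension B H K φ) = t * of (h : B) * t⁻¹ :=
      fun k => ⟨φ.symm k, by rw [← equiv_eq_conj, φ.apply_symm_apply]⟩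
    -- old suffixes do not meet the support of `δ`
    have hold : ∀ s, s <:+ l → W (syllableProd φ s) = 1 := by
      intro s
      induction s with
      | nil =>
        intro _
        simp [W]
      | cons q s ihs =>
        intro hs
        obtain ⟨u', g'⟩ := q
        have hs' : s <:+ l := (List.suffix_cons _ _).trans hs
        have hne : s ≠ l := fun e => by
          have := hs.length_le
          rw [e, List.length_cons] at this
          omega
        have hW := ihs hs'
        have hred : (u', g') :: s = l → u ≠ u' → ∀ x ∈ toSubgroup H K u,
            ρ (of x) ≠ ρ (of g) := fun e hu => by
          refine hsep fun hg => hu ?_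
          rw [← e] at hl
          exact (List.isChain_cons_cons.1 hl).1 hg
        have hcontra : ∀ x : B, x ∈ toSubgroup H K u → u ≠ u' →
            σ (syllableProd φ ((u', g') :: s)) = σ (of (x * g)) * σ (syllableProd φ l) → False := by
          intro x hx hu e
          have e1 := hσ _ _ hs (List.suffix_refl _) _ e
          rw [e1, eq_comm, mul_eq_right] at e
          refine hred e1 hu _ (inv_mem hx) (hσρ _ _ ?_)
          rw [map_mul, map_mul] at e
          rw [map_inv, map_inv]
          exact inv_eq_of_mul_eq_one_right e
        rcases Int.units_eq_one_or u' with rfl | rfl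
        · have h0 : δ (σ (t * (of g' * syllableProd φ s))) = 1 := by
            refine if_neg ?_
            rintro ⟨k, e⟩
            rcases Int.units_eq_one_or u with rfl | rfl
            · obtain ⟨h, hh⟩ := hk k
              rw [hv, if_pos rfl, ← map_mul, hh] at e
              refine hne (hσ _ _ hs' (List.suffix_refl _) (g'⁻¹ * h * g) ?_)
              have e2 := congrArg (fun x => (σ (t * of g'))⁻¹ * x) e
              simp only [← map_mul, ← map_inv] at e2 ⊢
              convert e2 using 2
              · group
              · simp only [map_mul, map_inv]
                group
            · rw [hv, if_neg (by decide), one_mul] at e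
              refine hcontra k k.2 (by decide) ?_
              rw [syllableProd_cons]
              simpa [mul_assoc] using e
          rw [syllableProd_cons]
          simp only [Units.val_one, zpow_one]
          rw [hWt, hWb, hW, h0, one_mul]
        · have h0 : δ (σ (of g' * syllableProd φ s)) = 1 := by
            refine if_neg ?_
            rintro ⟨k, e⟩
            rcases Int.units_eq_one_or u with rfl | rfl
            · obtain ⟨h, hh⟩ := hk k
              rw [hv, if_pos rfl, ← map_mul, hh] at e
              refine hcontra h h.2 (by decide) ?_
              have e2 := congrArg (fun x => (σ t)⁻¹ * x) e
              rw [syllableProd_cons]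
              simp only [Units.val_neg, Units.val_one, zpow_neg, zpow_one]
              simp only [← map_mul, ← map_inv] at e2 ⊢
              rw [e2]
              congr 1
              simp only [map_mul]
              group
            · rw [hv, if_neg (by decide), one_mul] at e
              refine hne (hσ _ _ hs' (List.suffix_refl _) (g'⁻¹ * k * g) ?_)
              have e2 := congrArg (fun x => (σ (of g'))⁻¹ * x) e
              simp only [← map_mul, ← map_inv] at e2 ⊢
              convert e2 using 2
              · simp only [map_inv, inv_mul_cancel_left]
              · simp only [map_mul, map_inv]
                group
          rw [syllableProd_cons]
          simp only [Units.val_neg, Units.val_one, zpow_neg, zpow_one]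
          rw [hWt', hWb, hW, h0, inv_one, one_mul]
    have hnew : W (syllableProd φ ((u, g) :: l)) ≠ 1 := by
      have h0 : δ v = z := if_pos ⟨1, by simp⟩
      rw [syllableProd_cons]
      rcases Int.units_eq_one_or u with rfl | rfl
      · rw [if_pos rfl] at hv
        simp only [Units.val_one, zpow_one]
        rwa [hWt, hWb, hold l (List.suffix_refl _), ← hv, h0, mul_one]
      · rw [if_neg (by decide), one_mul] at hv
        simp only [Units.val_neg, Units.val_one, zpow_neg, zpow_one]
        rw [hWt', hWb, hold l (List.suffix_refl _), ← hv, h0, mul_one]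
        exact inv_ne_one.2 hz
    have hFσ : ∀ x y, F x = F y → σ x = σ y := fun x y h => by rw [← hFr, h, hFr]
    refine ⟨_, _, F, hC.regularWreathProduct hCZ hY, fun x y h => hσρ x y (hFσ x y h), ?_⟩
    intro s₁ s₂ h₁ h₂ b e
    rw [← map_mul] at e
    have e1 := hFσ _ _ e
    have e2 : W (syllableProd φ s₁) = W (syllableProd φ s₂) := by
      rw [← hWb b (syllableProd φ s₂)]
      change (F _).left (σ _) = (F _).left (σ _)
      rw [e, e1]
    rcases List.suffix_cons_iff.1 h₁ with rfl | h₁ <;> rcases List.suffix_cons_iff.1 h₂ with rfl | h₂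
    · rfl
    · exact absurd (e2.trans (hold _ h₂)) hnew
    · exact absurd (e2.symm.trans (hold _ h₁)) hnew
    · exact hσ s₁ s₂ h₁ h₂ b (by rw [e1, map_mul])

/-- A criterion for an HNN-extension to be residually a `C`-group. -/
theorem residually_of_separates {C : GroupClass.{u}} (hC : IsRootClass C)
    (hH : ∀ b ∉ H, ∃ (X : Type u) (_ : Group X) (f : HNNExtension B H K φ →* X), C X ∧
      ∀ s ∈ H, f (of s) ≠ f (of b))
    (hK : ∀ b ∉ K, ∃ (X : Type u) (_ : Group X) (f : HNNExtension B H K φ →* X), C X ∧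
      ∀ s ∈ K, f (of s) ≠ f (of b))
    (hB : ∀ b ≠ 1, ∃ (X : Type u) (_ : Group X) (f : HNNExtension B H K φ →* X), C X ∧
      f (of b) ≠ 1) : Residually C (HNNExtension B H K φ) := by
  refine hC.residually_of_hom fun e he => ?_
  obtain ⟨g, l, hl, rfl⟩ := exists_reduced_eq e
  by_cases hnil : l = []
  · subst hnil
    rw [syllableProd_nil, mul_one] at he ⊢
    exact hB g (fun h => he (by rw [h, map_one]))
  · obtain ⟨X, _, ρ, hX, hρ⟩ := exists_separates hC hH hK l
    obtain ⟨Y, _, σ, hY, -, hσ⟩ := exists_separating_suffixes hC l hl hX ρ hρ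
    refine ⟨Y, _, σ, hY, fun h => hnil ?_⟩
    refine hσ l [] (List.suffix_refl _) List.nil_suffix g⁻¹ ?_
    rw [syllableProd_nil, map_one, mul_one, map_inv, map_inv]
    rw [map_mul] at h
    exact (inv_eq_of_mul_eq_one_right h).symm

end HNNExtension

theorem SemidirectProduct.map_inl_apply_eq_one_iff {L Γ : Type*} [Group L] [Group Γ]
    {V : Subgroup (MulAut L)} (κ : L ⋊[V.subtype] V →* Γ) (α : MulAut L) (hα : α ∈ V) (l : L) :
    κ (SemidirectProduct.inl (α l)) = 1 ↔ κ (SemidirectProduct.inl l) = 1 := by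
  have := SemidirectProduct.inl_aut (φ := V.subtype) ⟨α, hα⟩ l
  rw [Subgroup.coe_subtype] at this
  change SemidirectProduct.inl (α l) = _ at this
  rw [this, map_mul, map_mul, map_inv, map_inv, mul_inv_eq_one, mul_eq_left]

section

variable {C : GroupClass.{u}} (hC : IsRootClass C) (hquot : QuotClosed C) {B : Type u} [Group B]
  {H K L : Subgroup B} [H.Normal] [K.Normal] [L.Normal] (φ : H ≃* K)
  (hcond : ∀ b : B, ∃ c : B, ∀ h h' : H, (h' : B) = c * h * c⁻¹ → (φ h' : B) = b * φ h * b⁻¹)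
  (hL : ∀ x, x ∈ L ↔ x ∈ H ∧ x ∈ K) (hLφ : ∀ h : H, (h : B) ∈ K ↔ (φ h : B) ∈ H)
  (hqr : HomQuasiRegular C B (H ⊔ K))

include hC hquot hcond hL hLφ hqr

theorem exists_hom_separating_right (hK : Residually C (B ⧸ K)) (b : B) (hb : b ∉ K) :
    ∃ (X : Type u) (_ : Group X) (f : HNNExtension B H K φ →* X), C X ∧
      ∀ s ∈ K, f (.of s) ≠ f (.of b) := by
  obtain ⟨D, _, q, -, hD, hq⟩ := hK (b : B ⧸ K) (by rwa [Ne, QuotientGroup.eq_one_iff])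
  set N₀ : Subgroup B := (q.comp (QuotientGroup.mk' K)).ker with hN₀
  have hbN₀ : b ∉ N₀ := fun h => hq h
  have hKN₀ : K ≤ N₀ := fun k hk => by
    change q (QuotientGroup.mk' K k) = 1
    rw [QuotientGroup.mk'_apply, (QuotientGroup.eq_one_iff k).2 hk, map_one]
  have hCN₀ : C (B ⧸ N₀) := hC.quotient_ker _ hD
  obtain ⟨Q, _, hQ, -, -, X, _, f, τ, hX, hτ, hf⟩ := hC.exists_compatible_hom_of_le hquot φ hcond hL
    hLφ hqr (N₀ ⊓ H) inf_le_right
    (fun h hh => ⟨fun _ => ⟨hKN₀ (φ h).2, (hLφ h).1 hh⟩, fun _ => ⟨hKN₀ hh, h.2⟩⟩)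
    hCN₀ ((QuotientGroup.mk' N₀).comp H.subtype)
    (fun h hh => ⟨(QuotientGroup.eq_one_iff _).1 hh, h.2⟩) N₀ hCN₀ inf_le_left
    (fun h _ => hKN₀ (φ h).2)
  refine ⟨X, _, HNNExtension.lift f τ hτ, hX, fun s hs h => hbN₀ ?_⟩
  rw [HNNExtension.lift_of, HNNExtension.lift_of, ← inv_mul_eq_one, ← map_inv, ← map_mul, hf] at h
  have hle : L ⊔ Q ≤ N₀ := sup_le (fun x hx => hKN₀ ((hL x).1 hx).2) hQ
  exact (mul_mem_cancel_left (inv_mem (hKN₀ hs))).1 (hle h)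

theorem exists_hom_separating_left (hH : Residually C (B ⧸ H)) (b : B) (hb : b ∉ H) :
    ∃ (X : Type u) (_ : Group X) (f : HNNExtension B H K φ →* X), C X ∧
      ∀ s ∈ H, f (.of s) ≠ f (.of b) := by
  obtain ⟨D, _, q, -, hD, hq⟩ := hH (b : B ⧸ H) (by rwa [Ne, QuotientGroup.eq_one_iff])
  set N₀ : Subgroup B := (q.comp (QuotientGroup.mk' H)).ker with hN₀
  have hbN₀ : b ∉ N₀ := fun h => hq h
  have hHN₀ : H ≤ N₀ := fun k hk => by
    change q (QuotientGroup.mk' H k) = 1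
    rw [QuotientGroup.mk'_apply, (QuotientGroup.eq_one_iff k).2 hk, map_one]
  have hCN₀ : C (B ⧸ N₀) := hC.quotient_ker _ hD
  obtain ⟨η, hη, hηm⟩ := exists_extension_of_trivial_on_inf H K
    (((QuotientGroup.mk' N₀).comp K.subtype).comp φ.toMonoidHom)
    (fun h hh => (QuotientGroup.eq_one_iff _).2 (hHN₀ ((hLφ h).1 hh)))
  obtain ⟨N, hN, hCN, hNη⟩ := hqr _
    (MonoidHom.mk' (fun x : ↥(H ⊔ K) => η x) (fun x y => hηm x x.2 y y.2)) hCN₀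
  have hNφ : ∀ h : H, (h : B) ∈ N → (φ h : B) ∈ N₀ := fun h hh => by
    have h1 : η h = 1 := hNη ⟨h, le_sup_left (a := H) h.2⟩ hh
    rw [hη h h (by rw [inv_mul_cancel]; exact one_mem _)] at h1
    exact (QuotientGroup.eq_one_iff _).1 h1
  have hLH : L ≤ H := fun x hx => ((hL x).1 hx).1
  have hAH : (N ⊓ H) ⊔ L ≤ H := sup_le inf_le_right hLH
  obtain ⟨Q, _, hQ, -, -, X, _, f, τ, hX, hτ, hf⟩ := hC.exists_compatible_hom_of_le hquot φ hcond hL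
    hLφ hqr ((N ⊓ H) ⊔ L) hAH
    (fun h hh => ⟨fun _ => le_sup_right (a := N ⊓ H) ((hL _).2 ⟨(hLφ h).1 hh, (φ h).2⟩),
      fun _ => le_sup_right (a := N ⊓ H) ((hL _).2 ⟨h.2, hh⟩)⟩)
    hCN ((QuotientGroup.mk' N).comp H.subtype)
    (fun h hh => le_sup_left (a := N ⊓ H) ⟨(QuotientGroup.eq_one_iff _).1 hh, h.2⟩) N₀ hCN₀
    (hAH.trans hHN₀)
    (fun h hh => by
      obtain ⟨n, hn, l, hl, e⟩ := Subgroup.mem_sup_of_normal_left.1 hh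
      have e' : h = ⟨n, hn.2⟩ * ⟨l, hLH hl⟩ := Subtype.ext e.symm
      rw [e', map_mul, Subgroup.coe_mul]
      exact mul_mem (hNφ _ hn.1) (hHN₀ ((hLφ ⟨l, hLH hl⟩).1 ((hL l).1 hl).2)))
  refine ⟨X, _, HNNExtension.lift f τ hτ, hX, fun s hs h => hbN₀ ?_⟩
  rw [HNNExtension.lift_of, HNNExtension.lift_of, ← inv_mul_eq_one, ← map_inv, ← map_mul, hf] at h
  have hle : L ⊔ Q ≤ N₀ := sup_le (hLH.trans hHN₀) hQ
  exact (mul_mem_cancel_left (inv_mem (hHN₀ hs))).1 (hle h)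

variable (V : Subgroup (MulAut L)) (hV : ∀ b : B, MulAut.conjNormal b ∈ V) (ψ : MulAut L)
  (hψV : ψ ∈ V) (hψ : ∀ (l : L) (h : H), (h : B) = l → (ψ l : B) = φ h)

include hV hψV hψ

theorem exists_hom_separating_of_semidirectProduct {Γ : Type u} [Group Γ] (hΓ : C Γ)
    (κ : L ⋊[V.subtype] V →* Γ) (A : Subgroup B) [A.Normal] (hAH : A ≤ H)
    (hAφ : ∀ h : H, (h : B) ∈ K → ((h : B) ∈ A ↔ (φ h : B) ∈ A))
    {D : Type u} [Group D] (hD : C D) (f : H →* D) (hf : ∀ h, f h = 1 → (h : B) ∈ A)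
    (hAκ : ∀ l : L, (l : B) ∈ A → κ (SemidirectProduct.inl l) = 1)
    (l : L) (hl : κ (SemidirectProduct.inl l) ≠ 1) :
    ∃ (X : Type u) (_ : Group X) (f : HNNExtension B H K φ →* X), C X ∧ f (.of l) ≠ 1 := by
  have := QuotientGroup.subsingleton_quotient_top (G := B)
  obtain ⟨Q, _, -, hQA, hQφ, X, _, f, τ, hX, hτ, hf⟩ := hC.exists_compatible_hom_of_le hquot φ
    hcond hL hLφ hqr A hAH hAφ hD f hf ⊤ hC.of_subsingleton le_top (fun _ _ => trivial)
  obtain ⟨f', w, hw, hf'⟩ := exists_compatible_hom_of_semidirectProduct φ hL V hV ψ hψV hψ κ Q hQφ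
    (fun l hl => hAκ l (hQA l ((hL l).1 l.2).1 hl)) f τ hτ hf
  refine ⟨_, _, HNNExtension.lift f' w hw, hC.regularWreathProduct hΓ hX, ?_⟩
  rw [HNNExtension.lift_of]
  exact hf' l hl

theorem exists_hom_separating_of_injective (hCV : C V) {G : Type u} [Group G] (hG : C G)
    (σ : B →* G) (hσ : ∀ l ∈ L, σ l = 1 → l = 1) (l : L) (hl : l ≠ 1) :
    ∃ (X : Type u) (_ : Group X) (f : HNNExtension B H K φ →* X), C X ∧ f (.of l) ≠ 1 := by
  have hCL : C L := hC.of_injective (σ.comp L.subtype)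
    ((injective_iff_map_eq_one _).2 fun l h => Subtype.ext (hσ l l.2 h)) hG
  refine exists_hom_separating_of_semidirectProduct hC hquot φ hcond hL hLφ hqr V hV ψ hψV hψ
    (hC.semidirectProduct V.subtype hCL hCV) (MonoidHom.id _) (σ.ker ⊓ H) inf_le_right ?_ hG
    (σ.comp H.subtype) (fun h hh => ⟨hh, h.2⟩) ?_ l ?_
  · intro h hh
    constructor
    · intro hA
      have h1 : h = 1 := Subtype.ext (hσ h ((hL _).2 ⟨h.2, hh⟩) hA.1)
      rw [h1, map_one]
      exact one_mem _
    · intro hA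
      have h1 : φ h = 1 := Subtype.ext (hσ _ ((hL _).2 ⟨(hLφ h).1 hh, (φ h).2⟩) hA.1)
      rw [φ.map_eq_one_iff.1 h1]
      exact one_mem _
  · intro l hl
    have : l = 1 := Subtype.ext (hσ l l.2 hl.1)
    rw [this, map_one, map_one]
  · exact fun h => hl (SemidirectProduct.inl_injective (h.trans (map_one _).symm))

theorem exists_hom_separating_of_quotient (hCV : C V) {D : Type u} [Group D] (hD : C D) (f : H →* D)
    (hf : ∀ h, f h = 1 → (h : B) ∈ L) (hB : Residually C B) (l : L) (hl : l ≠ 1) :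
    ∃ (X : Type u) (_ : Group X) (f : HNNExtension B H K φ →* X), C X ∧ f (.of l) ≠ 1 := by
  obtain ⟨D₀, _, ξ, -, hD₀, hξ⟩ := hB l (fun h => hl (Subtype.ext h))
  have hr : ∀ x : (SemidirectProduct.rightHom : L ⋊[V.subtype] V →* V).ker, x.1.right = 1 :=
    fun x => x.2
  obtain ⟨Γ, _, κ, hΓ, hκ⟩ := hC.exists_hom_refining
    (SemidirectProduct.rightHom : L ⋊[V.subtype] V →* V) hCV
    (MonoidHom.mk' (fun x => ξ x.1.left) (fun x y => by simp [hr])) hD₀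
  have hκl : κ (SemidirectProduct.inl l) ≠ 1 := fun h => by
    obtain ⟨_, h1⟩ := hκ _ h
    exact hξ h1
  obtain ⟨A, hA⟩ : ∃ A : Subgroup B,
      A = ((κ.comp SemidirectProduct.inl).ker).map L.subtype := ⟨_, rfl⟩
  have hAmem : ∀ l : L, (l : B) ∈ A ↔ κ (SemidirectProduct.inl l) = 1 := fun l => by
    rw [hA]
    constructor
    · rintro ⟨l', hl', e⟩
      exact Subtype.ext e ▸ hl'
    · exact fun h => ⟨l, h, rfl⟩
  have hAL : A ≤ L := hA ▸ Subgroup.map_subtype_le _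
  have : A.Normal := ⟨fun a ha b => by
    have h1 := (SemidirectProduct.map_inl_apply_eq_one_iff κ _ (hV b) ⟨a, hAL ha⟩).2
      ((hAmem ⟨a, hAL ha⟩).1 ha)
    have h2 := (hAmem _).2 h1
    rwa [MulAut.conjNormal_apply] at h2⟩
  obtain ⟨D₁, _, f₁, hD₁, hf₁⟩ := hC.exists_hom_refining f hD
    ((κ.comp SemidirectProduct.inl).comp
      ((H.subtype.comp f.ker.subtype).codRestrict L (fun x => hf x.1 x.2))) hΓ
  refine exists_hom_separating_of_semidirectProduct hC hquot φ hcond hL hLφ hqr V hV ψ hψV hψ hΓ κ A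
    (hAL.trans fun x hx => ((hL x).1 hx).1) (fun h hh => ?_) hD₁ f₁ (fun h hh => ?_)
    (fun l hl => (hAmem l).1 hl) l hκl
  · have hhL : (h : B) ∈ L := (hL _).2 ⟨h.2, hh⟩
    rw [← hψ ⟨h, hhL⟩ h rfl, hAmem, SemidirectProduct.map_inl_apply_eq_one_iff κ _ hψV,
      ← hAmem]
  · obtain ⟨h1, h2⟩ := hf₁ h hh
    exact (hAmem ⟨h, hf h h1⟩).2 h2

theorem residually_of_residually_quotients (hCV : C V)
    (hαβ : (∃ (D : Type u) (_ : Group D) (f : H →* D), C D ∧ ∀ h, f h = 1 → (h : B) ∈ L) ∨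
      ∃ (G : Type u) (_ : Group G) (σ : B →* G), C G ∧ ∀ l ∈ L, σ l = 1 → l = 1)
    (hB : Residually C B) (hH : Residually C (B ⧸ H)) (hK : Residually C (B ⧸ K)) :
    Residually C (HNNExtension B H K φ) := by
  have h1 := exists_hom_separating_left hC hquot φ hcond hL hLφ hqr hH
  have h2 := exists_hom_separating_right hC hquot φ hcond hL hLφ hqr hK
  refine HNNExtension.residually_of_separates hC h1 h2 fun b hb => ?_
  by_cases hbH : b ∈ H
  · by_cases hbK : b ∈ K
    · have hbL := (hL b).2 ⟨hbH, hbK⟩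
      have hne : (⟨b, hbL⟩ : L) ≠ 1 := fun h => hb (congrArg Subtype.val h)
      rcases hαβ with ⟨D, _, f, hD, hf⟩ | ⟨G, _, σ, hG, hσ⟩
      · exact exists_hom_separating_of_quotient hC hquot φ hcond hL hLφ hqr V hV ψ hψV hψ hCV hD f
          hf hB ⟨b, hbL⟩ hne
      · exact exists_hom_separating_of_injective hC hquot φ hcond hL hLφ hqr V hV ψ hψV hψ hCV hG σ
          hσ ⟨b, hbL⟩ hne
    · obtain ⟨X, _, f, hX, hf⟩ := h2 b hbK
      exact ⟨X, _, f, hX, fun h => hf 1 (one_mem _) (by rw [h, map_one, map_one])⟩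
  · obtain ⟨X, _, f, hX, hf⟩ := h1 b hbH
    exact ⟨X, _, f, hX, fun h => hf 1 (one_mem _) (by rw [h, map_one, map_one])⟩

end

theorem Residually.of_injective {C : GroupClass.{u}} (hC : IsRootClass C) {X Y : Type u} [Group X]
    [Group Y] (f : X →* Y) (hf : Function.Injective f) (hY : Residually C Y) : Residually C X :=
  hC.residually_of_hom fun x hx => by
    obtain ⟨G, _, g, -, hG, hg⟩ := hY (f x) (fun h => hx (hf (h.trans (map_one f).symm)))
    exact ⟨G, _, g.comp f, hG, hg⟩

theorem IsRootClass.residually_quotient {C : GroupClass.{u}} (hC : IsRootClass C)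
    (hquot : QuotClosed C) {X : Type u} [Group X] (N : Subgroup X) [N.Normal]
    (h : ∀ x ∉ N, ∃ (G : Type u) (_ : Group G) (f : X →* G), C G ∧ ∀ n ∈ N, f x ≠ f n) :
    Residually C (X ⧸ N) := hC.residually_of_hom fun q hq => by
  obtain ⟨x, rfl⟩ := QuotientGroup.mk_surjective q
  obtain ⟨G, _, f, hG, hf⟩ := h x (by rwa [Ne, QuotientGroup.eq_one_iff] at hq)
  refine ⟨_, _, QuotientGroup.map N (N ⊔ f.ker) (MonoidHom.id X) le_sup_left,
    hC.quotient_of_le hquot le_sup_right (hC.quotient_ker f hG), fun h1 => ?_⟩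
  obtain ⟨n, hn, k, hk, rfl⟩ := Subgroup.mem_sup_of_normal_left.1 ((QuotientGroup.eq_one_iff x).1 h1)
  exact hf n hn (by rw [map_mul, MonoidHom.mem_ker.1 hk, mul_one])

namespace HNNExtension

variable {B : Type u} [Group B] {H K : Subgroup B} {φ : H ≃* K}

theorem syllableProd_ne_of {l : List (ℤˣ × B)}
    (hl : l.IsChain (fun a b => a.2 ∈ toSubgroup H K a.1 → a.1 = b.1)) (hne : l ≠ []) (b : B) :
    syllableProd φ l ≠ of b := fun h =>
  hne (ReducedWord.toList_eq_nil_of_mem_of_range φ ⟨1, l, hl⟩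
    ⟨b, by rw [← h]; simp [NormalWord.ReducedWord.prod, syllableProd]⟩)

theorem inv_mul_conj_commute [H.Normal] {b c : B}
    (hc : ∀ h h' : H, (h' : B) = c * h * c⁻¹ → (φ h' : B) = b * φ h * b⁻¹) (h : H) :
    Commute (of (h : B) : HNNExtension B H K φ) ((of c)⁻¹ * (t⁻¹ * of b * t)) := by
  have h1 := hc h ⟨c * h * c⁻¹, ‹H.Normal›.conj_mem _ h.2 c⟩ rfl
  have h2 := equiv_eq_conj (φ := φ) h
  have h3 := equiv_eq_conj (φ := φ) ⟨c * h * c⁻¹, ‹H.Normal›.conj_mem _ h.2 c⟩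
  rw [h1] at h3
  simp only [map_mul, map_inv] at h2 h3
  rw [h2] at h3
  have h4 : (of (h : B) : HNNExtension B H K φ) = (of c)⁻¹ * t⁻¹ *
      (t * (of c * of (h : B) * (of c)⁻¹) * t⁻¹) * t * of c := by group
  rw [← h3] at h4
  calc of (h : B) * ((of c)⁻¹ * (t⁻¹ * of b * t)) = _ := by rw [h4]
    _ = _ := by group

theorem commute_of_forall_mem_image {C : GroupClass.{u}}
    (hE : Residually C (HNNExtension B H K φ)) {z x : HNNExtension B H K φ}
    (hz : ∀ (X : Type u) (_ : Group X) (f : HNNExtension B H K φ →* X), C X →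
      ∃ h ∈ H, f z = f (of h)) (hx : ∀ h : H, Commute (of (h : B)) x) : Commute z x := by
  by_contra hne
  obtain ⟨G, _, f, -, hG, hf⟩ := hE (z * x * (x * z)⁻¹) (by rwa [Ne, mul_inv_eq_one])
  obtain ⟨h, hh, e⟩ := hz G _ f hG
  apply hf
  rw [map_mul, map_inv, mul_inv_eq_one, map_mul, map_mul, e, ← map_mul, ← map_mul]
  exact congrArg f (hx ⟨h, hh⟩)

theorem exists_separating_left [H.Normal] {C : GroupClass.{u}}
    (hcond : ∀ b : B, ∃ c : B, ∀ h h' : H, (h' : B) = c * h * c⁻¹ → (φ h' : B) = b * φ h * b⁻¹)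
    (hKT : K ≠ ⊤) (hE : Residually C (HNNExtension B H K φ)) {b : B} (hb : b ∉ H) :
    ∃ (X : Type u) (_ : Group X) (f : HNNExtension B H K φ →* X), C X ∧
      ∀ s ∈ H, f (of b) ≠ f (of s) := by
  by_contra! hno
  obtain ⟨a, ha⟩ : ∃ a, a ∉ K := by
    by_contra! h
    exact hKT (eq_top_iff.2 fun x _ => h x)
  obtain ⟨c, hc⟩ := hcond a
  have h1 := commute_of_forall_mem_image hE hno (inv_mul_conj_commute hc)
  refine syllableProd_ne_of (φ := φ) (l := [(-1, a), (1, b), (-1, a⁻¹), (1, 1)])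
    (by simp [ha, hb]) (by simp) (c * b * c⁻¹) ?_
  have h2 := congrArg (fun e => of c * e * (t⁻¹ * of a * t)⁻¹) h1.eq
  simp only [syllableProd_cons, syllableProd_nil, map_mul, map_inv, map_one, Units.val_one,
    Units.val_neg, zpow_one, zpow_neg]
  convert h2.symm using 1 <;> group

theorem exists_separating_right [H.Normal] {C : GroupClass.{u}}
    (hcond : ∀ b : B, ∃ c : B, ∀ h h' : H, (h' : B) = c * h * c⁻¹ → (φ h' : B) = b * φ h * b⁻¹)
    (hHT : H ≠ ⊤) (hE : Residually C (HNNExtension B H K φ)) {b : B} (hb : b ∉ K) :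
    ∃ (X : Type u) (_ : Group X) (f : HNNExtension B H K φ →* X), C X ∧
      ∀ s ∈ K, f (of b) ≠ f (of s) := by
  by_contra! hno
  obtain ⟨a, ha⟩ : ∃ a, a ∉ H := by
    by_contra! h
    exact hHT (eq_top_iff.2 fun x _ => h x)
  obtain ⟨c, hc⟩ := hcond b
  have hy : ∀ (X : Type u) (_ : Group X) (f : HNNExtension B H K φ →* X), C X →
      ∃ h ∈ H, f (t⁻¹ * of b * t) = f (of h) := fun X _ f hX => by
    obtain ⟨s, hs, e⟩ := hno X _ f hX
    refine ⟨φ.symm ⟨s, hs⟩, (φ.symm ⟨s, hs⟩).2, ?_⟩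
    rw [equiv_symm_eq_conj, map_mul, map_mul, map_mul, map_mul, e]
  have hx := inv_mul_conj_commute hc
  by_cases hcH : c ∈ H
  · have h1 := commute_of_forall_mem_image hE hy (x := of a * ((of c)⁻¹ * (t⁻¹ * of b * t)) *
      (of a)⁻¹) fun h => by
        have h2 := hx ⟨a⁻¹ * h * a⁻¹⁻¹, ‹H.Normal›.conj_mem _ h.2 _⟩
        have h3 := (Commute.conj_iff (of a)).2 h2
        convert h3 using 1
        simp only [map_mul, map_inv]
        group
    have hac : a * c⁻¹ ∉ H := fun h => ha ((mul_mem_cancel_right (inv_mem hcH)).1 h)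
    refine syllableProd_ne_of (φ := φ) (l := [(-1, b), (1, a * c⁻¹), (-1, b), (1, a⁻¹), (-1, b⁻¹),
      (1, a), (-1, b⁻¹), (1, 1)]) (by simp [ha, hb, hac]) (by simp) (a * c⁻¹) ?_
    have h2 := congrArg (fun e => e * (t⁻¹ * of b * t)⁻¹ * of a * (t⁻¹ * of b * t)⁻¹) h1.eq
    simp only [syllableProd_cons, syllableProd_nil, map_mul, map_inv, map_one, Units.val_one,
      Units.val_neg, zpow_one, zpow_neg]
    convert h2 using 1 <;> group
  · have h1 := commute_of_forall_mem_image hE hy hx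
    refine syllableProd_ne_of (φ := φ) (l := [(-1, b), (1, c⁻¹), (-1, b⁻¹), (1, 1)])
      (by simp [hb, hcH]) (by simp) c⁻¹ ?_
    have h2 := congrArg (fun e => e * (t⁻¹ * of b * t)⁻¹ * (t⁻¹ * of b * t)⁻¹) h1.eq
    simp only [syllableProd_cons, syllableProd_nil, map_inv, map_one, Units.val_one,
      Units.val_neg, zpow_one, zpow_neg]
    convert h2 using 1 <;> group

theorem residually_quotients_of_residually [H.Normal] [K.Normal] {C : GroupClass.{u}}
    (hC : IsRootClass C) (hquot : QuotClosed C)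
    (hcond : ∀ b : B, ∃ c : B, ∀ h h' : H, (h' : B) = c * h * c⁻¹ → (φ h' : B) = b * φ h * b⁻¹)
    (hLφ : ∀ h : H, (h : B) ∈ K ↔ (φ h : B) ∈ H) (hE : Residually C (HNNExtension B H K φ)) :
    Residually C (B ⧸ H) ∧ Residually C (B ⧸ K) := by
  have hHK : H = ⊤ ↔ K = ⊤ := by
    refine ⟨fun h => eq_top_iff.2 fun x _ => ?_, fun h => eq_top_iff.2 fun x _ => ?_⟩
    · have hx : x ∈ H := by rw [h]; trivial
      exact (hLφ ⟨x, hx⟩).2 ((Subgroup.eq_top_iff' H).1 h _)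
    · have hx : x ∈ K := by rw [h]; trivial
      have h1 := (hLφ (φ.symm ⟨x, hx⟩)).1 ((Subgroup.eq_top_iff' K).1 h _)
      rwa [φ.apply_symm_apply] at h1
  refine ⟨hC.residually_quotient hquot H fun b hb => ?_,
    hC.residually_quotient hquot K fun b hb => ?_⟩
  · obtain ⟨X, _, f, hX, hf⟩ := exists_separating_left hcond
      (fun h => hb (by rw [hHK.2 h]; trivial)) hE hb
    exact ⟨X, _, f.comp of, hX, hf⟩
  · obtain ⟨X, _, f, hX, hf⟩ := exists_separating_right hcond
      (fun h => hb (by rw [hHK.1 h]; trivial)) hE hb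
    exact ⟨X, _, f.comp of, hX, hf⟩

/-- The homomorphism to the HNN-extension with the associated subgroups interchanged. -/
def symmHom (φ : H ≃* K) : HNNExtension B H K φ →* HNNExtension B K H φ.symm :=
  lift of t⁻¹ fun h => by
    have := equiv_symm_eq_conj (φ := φ.symm) h
    rw [MulEquiv.symm_symm] at this
    rw [this]
    group

theorem symmHom_of (φ : H ≃* K) (b : B) : symmHom φ (of b) = of b := lift_of ..

theorem symmHom_t (φ : H ≃* K) : symmHom φ t = t⁻¹ := lift_t ..

theorem symmHom_injective (φ : H ≃* K) : Function.Injective (symmHom φ) := by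
  have h : (symmHom φ.symm).comp (symmHom φ) = MonoidHom.id (HNNExtension B H K φ) := by
    refine hom_ext ?_ ?_
    · ext b
      change symmHom φ.symm (symmHom φ (of b)) = of b
      exact (congrArg _ (symmHom_of φ b)).trans (symmHom_of φ.symm b)
    · change symmHom φ.symm (symmHom φ t) = t
      rw [symmHom_t, map_inv, inv_eq_iff_eq_inv]
      exact symmHom_t φ.symm
  exact Function.LeftInverse.injective (g := symmHom φ.symm) fun e => DFunLike.congr_fun h e

end HNNExtension

theorem residually_iff_of_cond {C : GroupClass.{u}} (hC : IsRootClass C) (hquot : QuotClosed C)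
    {B : Type u} [Group B] {H K L : Subgroup B} [H.Normal] [K.Normal] [L.Normal] (φ : H ≃* K)
    (hcond : ∀ b : B, ∃ c : B, ∀ h h' : H, (h' : B) = c * h * c⁻¹ → (φ h' : B) = b * φ h * b⁻¹)
    (hL : ∀ x, x ∈ L ↔ x ∈ H ∧ x ∈ K) (hLφ : ∀ h : H, (h : B) ∈ K ↔ (φ h : B) ∈ H)
    (hqr : HomQuasiRegular C B (H ⊔ K)) (V : Subgroup (MulAut L))
    (hV : ∀ b : B, MulAut.conjNormal b ∈ V) (ψ : MulAut L) (hψV : ψ ∈ V)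
    (hψ : ∀ (l : L) (h : H), (h : B) = l → (ψ l : B) = φ h) (hCV : C V)
    (hαβ : (∃ (D : Type u) (_ : Group D) (f : H →* D), C D ∧ ∀ h, f h = 1 → (h : B) ∈ L) ∨
      ∃ (G : Type u) (_ : Group G) (σ : B →* G), C G ∧ ∀ l ∈ L, σ l = 1 → l = 1) :
    Residually C (HNNExtension B H K φ) ↔
      (Residually C B ∧ Residually C (B ⧸ H) ∧ Residually C (B ⧸ K)) :=
  ⟨fun hE => ⟨.of_injective hC HNNExtension.of (HNNExtension.of_injective φ) hE,
    HNNExtension.residually_quotients_of_residually hC hquot hcond hLφ hE⟩,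
    fun ⟨hB, hH, hK⟩ => residually_of_residually_quotients hC hquot φ hcond hL hLφ hqr V hV ψ hψV
      hψ hCV hαβ hB hH hK⟩

theorem statement_5 (C : GroupClass.{u}) (hroot : IsRootClass C) (hquot : QuotClosed C)
    {B : Type u} [Group B] (H K : Subgroup B) (φ : H ≃* K)
    (hH : H.Normal) (hK : K.Normal)
    (ψ : MulAut ↥(H ⊓ K)) (hψ : IsRestrictionToL H K φ ψ)
    (halphabeta : (C (↥H ⧸ (H ⊓ K).subgroupOf H) ∨
      ∃ (G : Type u) (_ : Group G) (σ : B →* G), Function.Surjective σ ∧ C G ∧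
        Function.Injective (σ.comp (H ⊓ K).subtype)))
    (hUeq : frakU H K φ = autOf B H ∨ frakU H K φ = frakK H K φ)
    (hV : C ↥(frakV H K ψ))
    (hqr : QuasiRegular C B (H ⊔ K)) :
    Residually C (HNNExtension B H K φ) ↔
      (Residually C B ∧ Residually C (B ⧸ H) ∧ Residually C (B ⧸ K)) := by
  have hLφ : ∀ h : H, (h : B) ∈ K ↔ (φ h : B) ∈ H := fun h => by
    refine ⟨fun hK' => ?_, fun hH' => ?_⟩
    · have h1 := hψ ⟨h, h.2, hK'⟩
      rw [← h1]
      exact (ψ _).2.1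
    · have h1 := hψ (ψ.symm ⟨φ h, hH', (φ h).2⟩)
      rw [MulEquiv.apply_symm_apply] at h1
      have h2 := φ.injective (Subtype.ext h1)
      rw [h2]
      exact (ψ.symm ⟨φ h, hH', (φ h).2⟩).2.2
  have hφL : ∀ (l : ↥(H ⊓ K)) (h : H), (h : B) = l → (ψ l : B) = φ h := fun l h e => by
    rw [hψ l]
    exact congrArg (fun x => (φ x : B)) (Subtype.ext e.symm)
  have hVb : ∀ b : B, (MulAut.conjNormal b : MulAut ↥(H ⊓ K)) ∈ frakV H K ψ := fun b =>
    le_sup_left (a := autOf B (H ⊓ K)) ⟨b, fun y => MulAut.conjNormal_apply b y⟩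
  have hψV : ψ ∈ frakV H K ψ :=
    le_sup_right (a := autOf B (H ⊓ K)) (Subgroup.mem_zpowers ψ)
  have hqr' := hroot.homQuasiRegular hqr
  have hαβ : (∃ (D : Type u) (_ : Group D) (f : H →* D), C D ∧ ∀ h, f h = 1 → (h : B) ∈ H ⊓ K) ∨
      ∃ (G : Type u) (_ : Group G) (σ : B →* G), C G ∧ ∀ l ∈ H ⊓ K, σ l = 1 → l = 1 := by
    rcases halphabeta with h | ⟨G, _, σ, -, hG, hσ⟩
    · exact .inl ⟨_, _, QuotientGroup.mk' ((H ⊓ K).subgroupOf H), h,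
        fun x hx => (QuotientGroup.eq_one_iff x).1 hx⟩
    · refine .inr ⟨G, _, σ, hG, fun l hl h => ?_⟩
      have h1 := @hσ ⟨l, hl⟩ 1 (by simpa using h)
      exact congrArg Subtype.val h1
  rcases hUeq with hU | hU
  · refine residually_iff_of_cond hroot hquot φ (fun b => ?_) (fun _ => Subgroup.mem_inf) hLφ hqr'
      (frakV H K ψ) hVb ψ hψV hφL hV hαβ
    have h1 : autConjHom φ (MulAut.conjNormal b) ∈ autOf B H := by
      rw [← hU]
      exact le_sup_right (a := autOf B H)
        ⟨_, ⟨b, fun y => MulAut.conjNormal_apply b y⟩, rfl⟩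
    obtain ⟨c, hc⟩ := h1
    refine ⟨c, fun h h' e => ?_⟩
    rw [← hc h] at e
    rw [Subtype.ext e]
    simp [autConjHom]
  · refine (Iff.intro (.of_injective hroot _ (HNNExtension.symmHom_injective φ.symm))
      (.of_injective hroot _ (HNNExtension.symmHom_injective φ))).trans
      ((residually_iff_of_cond hroot hquot φ.symm (fun b => ?_)
        (fun x => Subgroup.mem_inf.trans and_comm) (fun k => ?_) (by rwa [sup_comm])
        (frakV H K ψ) hVb ψ⁻¹ (inv_mem hψV) (fun l k e => ?_) hV ?_).trans
        (and_congr_right' and_comm))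
    · have h1 : (MulAut.conjNormal b : MulAut H) ∈ frakK H K φ := by
        rw [← hU]
        exact le_sup_left (a := autOf B H) ⟨b, fun y => MulAut.conjNormal_apply b y⟩
      obtain ⟨α, ⟨c, hc⟩, hα⟩ := h1
      refine ⟨c, fun k k' e => ?_⟩
      rw [← hc k] at e
      have h2 := congrArg (fun β : MulAut H => ((β (φ.symm k) : H) : B)) hα
      rw [Subtype.ext e]
      simpa [autConjHom, MulAut.conjNormal_apply] using h2
    · have h1 := hLφ (φ.symm k)
      rw [φ.apply_symm_apply] at h1
      exact h1.symm
    · have h1 := hφL (ψ⁻¹ l) ⟨(ψ⁻¹ l : ↥(H ⊓ K)), (ψ⁻¹ l).2.1⟩ rfl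
      rw [MulAut.apply_inv_self, ← e] at h1
      rw [Subtype.ext h1, φ.symm_apply_apply]
    · rcases hαβ with ⟨D, _, f, hD, hf⟩ | h
      · refine .inl ⟨D, _, f.comp φ.symm.toMonoidHom, hD, fun k hk => ?_⟩
        have h1 := (hLφ _).1 (hf _ hk).2
        change (φ (φ.symm k) : B) ∈ H at h1
        rw [φ.apply_symm_apply] at h1
        exact ⟨h1, k.2⟩
      · exact .inr h
end
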